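/- arXiv:2512.09308 — 4 statements merged into one kernel-verified Lean document; each statement's English description precedes it below -/
import Mathlib

section
/- Let β ∈ (0,1). For every s ≥ 0, the Mittag-Leffler function satisfies the two-sided bound 1/(1 + Γ(1−β)·s) ≤ E_β(−s) ≤ 1/(1 + s/Γ(1+β)). -/
open Real Filter Topology

/-- The Mittag-Leffler function `E_β(s) = ∑_{k=0}^∞ s^k / Γ(1 + βk)`. -/
noncomputable def mittagLeffler (β s : ℝ) : ℝ := ∑' k : ℕ, s ^ k / Real.Gamma (1 + β * k)

open MeasureTheory

namespace MLAux

/-- Crude lower bound on the Gamma function. -/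
lemma Gamma_lower {M x : ℝ} (hM : 0 < M) (hx : 1 ≤ x) :
    Real.exp (-(M + 1)) * M ^ (x - 1) ≤ Real.Gamma x := by
  rw [Real.Gamma_eq_integral (by linarith)]
  have hint := Real.GammaIntegral_convergent (s := x) (by linarith)
  have hsub : Set.Ioc M (M + 1) ⊆ Set.Ioi 0 := fun y hy => lt_trans hM hy.1
  calc Real.exp (-(M + 1)) * M ^ (x - 1)
      = ∫ y in Set.Ioc M (M + 1), Real.exp (-(M + 1)) * M ^ (x - 1) := by simp
    _ ≤ ∫ y in Set.Ioc M (M + 1), Real.exp (-y) * y ^ (x - 1) := by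
        apply setIntegral_mono_on
        · exact integrableOn_const (by simp)
        · exact hint.mono_set hsub
        · exact measurableSet_Ioc
        · intro y hy
          have h1 : Real.exp (-(M + 1)) ≤ Real.exp (-y) := by
            apply Real.exp_le_exp.2; linarith [hy.2]
          have h2 : M ^ (x - 1) ≤ y ^ (x - 1) :=
            Real.rpow_le_rpow hM.le hy.1.le (by linarith)
          have h3 : 0 ≤ M ^ (x - 1) := Real.rpow_nonneg hM.le _
          exact mul_le_mul h1 h2 h3 (Real.exp_pos _).le
    _ ≤ _ := by
        apply setIntegral_mono_set hint
        · refine (ae_restrict_iff' measurableSet_Ioi).2 (Eventually.of_forall fun y hy => ?_)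
          exact mul_nonneg (Real.exp_pos _).le (Real.rpow_nonneg (le_of_lt hy) _)
        · exact hsub.eventuallyLE

lemma summable_aux {β c : ℝ} (hβ : 0 < β) (hc : 0 < c) {R : ℝ} (hR : 0 ≤ R) :
    Summable fun k : ℕ => R ^ k / Real.Gamma (β * k + c) := by
  set M : ℝ := (R + 1) ^ (1 / β) with hMdef
  have hM : 0 < M := Real.rpow_pos_of_pos (by linarith) _
  have hMb : M ^ β = R + 1 := by
    rw [hMdef, ← Real.rpow_mul (by linarith)]; field_simp; simp
  have hg : Summable fun k : ℕ => (Real.exp (M + 1) * M ^ (1 - c)) * (R / (R + 1)) ^ k := by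
    apply Summable.mul_left
    apply summable_geometric_of_lt_one (by positivity)
    rw [div_lt_one (by linarith)]; linarith
  apply Summable.of_norm_bounded_eventually_nat hg
  have hev : ∀ᶠ k : ℕ in atTop, 1 / β ≤ (k : ℝ) :=
    tendsto_natCast_atTop_atTop.eventually_ge_atTop _
  filter_upwards [hev] with k hk
  have hk1 : 1 ≤ β * k + c := by
    have : 1 ≤ k * β := by rwa [div_le_iff₀ hβ] at hk
    linarith
  have hG := Gamma_lower hM hk1
  have hGpos : 0 < Real.Gamma (β * k + c) := Real.Gamma_pos_of_pos (by linarith)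
  rw [Real.norm_of_nonneg (by positivity), div_le_iff₀ hGpos]
  have e1 : M ^ (β * k + c - 1) = (R + 1) ^ k * M ^ (c - 1) := by
    rw [add_sub_assoc, Real.rpow_add hM, Real.rpow_mul hM.le, hMb, Real.rpow_natCast]
  have e2 : M ^ (1 - c) * M ^ (c - 1) = 1 := by
    rw [← Real.rpow_add hM]; simp
  have e3 : Real.exp (M + 1) * Real.exp (-(M + 1)) = 1 := by
    rw [← Real.exp_add]; simp
  have e4 : (R / (R + 1)) ^ k * (R + 1) ^ k = R ^ k := by
    rw [← mul_pow, div_mul_cancel₀ _ (by linarith)]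
  calc R ^ k = (Real.exp (M + 1) * M ^ (1 - c)) * (R / (R + 1)) ^ k *
        (Real.exp (-(M + 1)) * M ^ (β * k + c - 1)) := by
        rw [e1]
        calc R ^ k = 1 * 1 * R ^ k := by ring
          _ = (Real.exp (M + 1) * Real.exp (-(M + 1))) * (M ^ (1 - c) * M ^ (c - 1)) *
                ((R / (R + 1)) ^ k * (R + 1) ^ k) := by rw [e2, e3, e4]
          _ = _ := by ring
    _ ≤ _ := by
        apply mul_le_mul_of_nonneg_left hG
        positivity

/-- Two-parameter Mittag-Leffler function at `-x`. -/
noncomputable def mlG (β c x : ℝ) : ℝ := ∑' k : ℕ, (-x) ^ k / Real.Gamma (β * k + c)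

lemma summable_mlG {β c : ℝ} (hβ : 0 < β) (hc : 0 < c) (x : ℝ) :
    Summable fun k : ℕ => (-x) ^ k / Real.Gamma (β * k + c) := by
  apply Summable.of_norm
  refine (summable_aux hβ hc (abs_nonneg x)).congr fun k => ?_
  have hGpos : 0 < Real.Gamma (β * k + c) := Real.Gamma_pos_of_pos (by positivity)
  rw [norm_div, norm_pow, norm_neg, Real.norm_eq_abs, Real.norm_of_nonneg hGpos.le]

lemma continuous_mlG {β c : ℝ} (hβ : 0 < β) (hc : 0 < c) : Continuous (mlG β c) := by
  rw [← continuousOn_univ]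
  have : ∀ x₀ : ℝ, ContinuousAt (mlG β c) x₀ := by
    intro x₀
    have h : ContinuousOn (mlG β c) (Metric.ball 0 (|x₀| + 1)) := by
      unfold mlG
      apply continuousOn_tsum (u := fun k : ℕ => (|x₀| + 1) ^ k / Real.Gamma (β * k + c))
      · intro k; fun_prop
      · exact summable_aux hβ hc (by positivity)
      · intro k x hx
        have hGpos : 0 < Real.Gamma (β * k + c) := Real.Gamma_pos_of_pos (by positivity)
        rw [norm_div, norm_pow, norm_neg, Real.norm_of_nonneg hGpos.le]
        rw [mem_ball_zero_iff] at hx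
        gcongr
    exact h.continuousAt (Metric.isOpen_ball.mem_nhds (by simp))
  exact fun x _ => (this x).continuousWithinAt

lemma mlG_zero (β c : ℝ) : mlG β c 0 = 1 / Real.Gamma c := by
  unfold mlG
  rw [tsum_eq_single 0]
  · simp
  · intro k hk; simp [hk]

lemma mlG_rec {β c : ℝ} (hβ : 0 < β) (hc : 0 < c) (x : ℝ) :
    mlG β c x = 1 / Real.Gamma c - x * mlG β (c + β) x := by
  unfold mlG
  rw [(summable_mlG hβ hc x).tsum_eq_zero_add, ← tsum_mul_left, sub_eq_add_neg, ← tsum_neg]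
  congr 1
  · simp
  · congr 1; ext k
    push_cast
    rw [show β * (k + 1) + c = β * k + (c + β) by ring, pow_succ]; ring

/-- Real beta integral on `[0,t]`. -/
lemma beta_real {a b t : ℝ} (ha : 0 < a) (hb : 0 < b) (ht : 0 < t) :
    ∫ x in (0:ℝ)..t, x ^ (b - 1) * (t - x) ^ (a - 1) =
      t ^ (a + b - 1) * (Real.Gamma a * Real.Gamma b / Real.Gamma (a + b)) := by
  have h := Complex.betaIntegral_scaled (b : ℂ) (a : ℂ) ht
  rw [Complex.betaIntegral_eq_Gamma_mul_div _ _ (by simpa) (by simpa)] at h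
  have h2 : ∫ x in (0:ℝ)..t, (x : ℂ) ^ ((b : ℂ) - 1) * ((t : ℂ) - x) ^ ((a : ℂ) - 1)
      = ∫ x in (0:ℝ)..t, ((x ^ (b - 1) * (t - x) ^ (a - 1) : ℝ) : ℂ) := by
    apply intervalIntegral.integral_congr
    intro x hx
    rw [Set.uIcc_of_le ht.le] at hx
    simp only
    push_cast
    rw [Complex.ofReal_cpow hx.1, Complex.ofReal_cpow (by linarith [hx.2])]
    push_cast; rfl
  rw [h2, intervalIntegral.integral_ofReal, ← Complex.ofReal_add, Complex.Gamma_ofReal,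
    Complex.Gamma_ofReal, Complex.Gamma_ofReal] at h
  apply Complex.ofReal_injective
  rw [h]
  push_cast
  rw [Complex.ofReal_cpow ht.le, add_comm a b]
  push_cast; ring

lemma beta_pos {a b t : ℝ} (ha : 0 < a) (hb : 0 < b) (ht : 0 < t) :
    0 < t ^ (a + b - 1) * (Real.Gamma a * Real.Gamma b / Real.Gamma (a + b)) := by
  have := Real.Gamma_pos_of_pos ha
  have := Real.Gamma_pos_of_pos hb
  have := Real.Gamma_pos_of_pos (add_pos ha hb)
  positivity

lemma beta_int {a b t : ℝ} (ha : 0 < a) (hb : 0 < b) (ht : 0 < t) :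
    IntervalIntegrable (fun x : ℝ => x ^ (b - 1) * (t - x) ^ (a - 1)) volume 0 t := by
  apply intervalIntegral.intervalIntegrable_of_integral_ne_zero
  rw [beta_real ha hb ht]
  exact (beta_pos ha hb ht).ne'

/-- `W c t = t^(c-1) E_{β,c}(-t^β)`. -/
noncomputable def W (β c t : ℝ) : ℝ := t ^ (c - 1) * mlG β c (t ^ β)

lemma conv_int {β a c t : ℝ} (hβ : 0 < β) (ha : 0 < a) (hc : 0 < c) (ht : 0 < t) :
    IntervalIntegrable (fun x : ℝ => (t - x) ^ (a - 1) * W β c x) volume 0 t := by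
  have h := (beta_int ha hc ht).mul_continuousOn (g := fun x => mlG β c (x ^ β)) (by
    apply Continuous.continuousOn
    exact (continuous_mlG hβ hc).comp (Real.continuous_rpow_const hβ.le))
  convert! h using 1
  ext x; unfold W; ring

lemma conv_eq {β a c t : ℝ} (hβ : 0 < β) (ha : 0 < a) (hc : 0 < c) (ht : 0 < t) :
    ∫ x in (0:ℝ)..t, (t - x) ^ (a - 1) * W β c x = Real.Gamma a * W β (c + a) t := by
  have hΓ : ∀ k : ℕ, 0 < Real.Gamma (β * k + c) := fun k => Real.Gamma_pos_of_pos (by positivity)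
  have hΓa : 0 < Real.Gamma a := Real.Gamma_pos_of_pos ha
  have hck : ∀ k : ℕ, 0 < β * k + c := fun k => by positivity
  let F : ℕ → ℝ → ℝ := fun k x =>
    ((-1) ^ k / Real.Gamma (β * k + c)) * (x ^ (β * k + c - 1) * (t - x) ^ (a - 1))
  have hpow : ∀ k : ℕ, t ^ (a + (β * k + c) - 1) = (t ^ β) ^ k * t ^ (c + a - 1) := by
    intro k
    rw [show a + (β * k + c) - 1 = β * k + (c + a - 1) by ring, Real.rpow_add ht,
      Real.rpow_mul ht.le, Real.rpow_natCast]
  have hFint : ∀ k, Integrable (F k) (volume.restrict (Set.Ioc 0 t)) := by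
    intro k
    have := (beta_int ha (hck k) ht).const_mul ((-1) ^ k / Real.Gamma (β * k + c))
    exact (intervalIntegrable_iff_integrableOn_Ioc_of_le ht.le).1 this
  have hnorm : ∀ k, ∫ x in Set.Ioc 0 t, ‖F k x‖ =
      Real.Gamma a * t ^ (c + a - 1) * ((t ^ β) ^ k / Real.Gamma (β * k + (c + a))) := by
    intro k
    have : ∫ x in Set.Ioc 0 t, ‖F k x‖ = ∫ x in Set.Ioc 0 t,
        (1 / Real.Gamma (β * k + c)) * (x ^ (β * k + c - 1) * (t - x) ^ (a - 1)) := by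
      apply setIntegral_congr_fun measurableSet_Ioc
      intro x hx
      have h1 : 0 ≤ x ^ (β * k + c - 1) := Real.rpow_nonneg hx.1.le _
      have h2 : 0 ≤ (t - x) ^ (a - 1) := Real.rpow_nonneg (by linarith [hx.2]) _
      simp only [F]
      rw [norm_mul, norm_div, norm_pow, norm_neg, norm_one, one_pow,
        Real.norm_of_nonneg (hΓ k).le, Real.norm_of_nonneg (mul_nonneg h1 h2)]
    rw [this, ← intervalIntegral.integral_of_le ht.le, intervalIntegral.integral_const_mul,
      beta_real ha (hck k) ht, hpow, show a + (β * k + c) = β * k + (c + a) by ring]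
    have := (hΓ k).ne'
    field_simp
  have hval : ∀ k, ∫ x in Set.Ioc 0 t, F k x =
      Real.Gamma a * t ^ (c + a - 1) * ((-(t ^ β)) ^ k / Real.Gamma (β * k + (c + a))) := by
    intro k
    simp only [F]
    rw [← intervalIntegral.integral_of_le ht.le, intervalIntegral.integral_const_mul,
      beta_real ha (hck k) ht, hpow, show a + (β * k + c) = β * k + (c + a) by ring, neg_pow (t ^ β)]
    have := (hΓ k).ne'
    field_simp
  have hs := hasSum_integral_of_summable_integral_norm hFint (by
    simp_rw [hnorm]
    exact (summable_aux hβ (add_pos hc ha) (by positivity)).mul_left _)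
  have e1 := hs.tsum_eq
  simp_rw [hval] at e1
  rw [tsum_mul_left] at e1
  rw [intervalIntegral.integral_of_le ht.le]
  have e2 : ∫ x in Set.Ioc 0 t, ∑' k, F k x =
      ∫ x in Set.Ioc 0 t, (t - x) ^ (a - 1) * W β c x := by
    apply setIntegral_congr_fun measurableSet_Ioc
    intro x hx
    have hx0 : 0 < x := hx.1
    simp only [F, W, mlG]
    rw [← mul_assoc, ← tsum_mul_left]
    congr 1; ext k
    rw [show β * k + c - 1 = β * k + (c - 1) by ring, Real.rpow_add hx0,
      Real.rpow_mul hx0.le, Real.rpow_natCast, neg_pow (x ^ β)]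
    ring
  rw [← e2, ← e1]
  unfold W mlG; ring

lemma W_rec {β c t : ℝ} (hβ : 0 < β) (hc : 0 < c) (ht : 0 < t) :
    W β c t = t ^ (c - 1) / Real.Gamma c - W β (c + β) t := by
  unfold W
  rw [mlG_rec hβ hc, show c + β - 1 = (c - 1) + β by ring, Real.rpow_add ht]; ring

lemma ker_eq {β t u : ℝ} (hβ : 0 < β) :
    ∫ x in t..u, (u - x) ^ (β - 1) = (u - t) ^ β / β := by
  rw [intervalIntegral.integral_comp_sub_left (fun x => x ^ (β - 1)) u,
    integral_rpow (Or.inl (by linarith))]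
  simp [Real.zero_rpow hβ.ne']

lemma ker_int {β t u : ℝ} (hβ : 0 < β) (htu : t < u) :
    IntervalIntegrable (fun x : ℝ => (u - x) ^ (β - 1)) volume t u := by
  apply intervalIntegral.intervalIntegrable_of_integral_ne_zero
  rw [ker_eq hβ]
  have : 0 < u - t := by linarith
  positivity

lemma conv_r {β t : ℝ} (hβ : 0 < β) (ht : 0 < t) :
    ∫ x in (0:ℝ)..t, (t - x) ^ (β - 1) * W β β x = t ^ (β - 1) - Real.Gamma β * W β β t := by
  rw [conv_eq hβ hβ hβ ht, W_rec hβ hβ ht]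
  have := (Real.Gamma_pos_of_pos hβ).ne'
  field_simp
  ring

lemma W_pos {β : ℝ} (hβ : 0 < β) (hβ1 : β < 1) {t : ℝ} (ht : 0 < t) : 0 < W β β t := by
  set H : ℝ → ℝ := fun t => mlG β β (t ^ β) with hH
  have hHc : Continuous H := (continuous_mlG hβ hβ).comp (Real.continuous_rpow_const hβ.le)
  have hΓ : 0 < Real.Gamma β := Real.Gamma_pos_of_pos hβ
  have hH0 : 0 < H 0 := by
    simp only [hH, Real.zero_rpow hβ.ne', mlG_zero]; positivity
  have hW : ∀ t, W β β t = t ^ (β - 1) * H t := fun t => rfl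
  suffices hmain : 0 < H t by
    rw [hW]; positivity
  by_contra hneg
  push Not at hneg
  set S : Set ℝ := {x | 0 ≤ x ∧ H x ≤ 0} with hS
  have hSc : IsClosed S := by
    rw [hS, Set.ofPred_and]
    exact (isClosed_le continuous_const continuous_id).inter (isClosed_le hHc continuous_const)
  have hSb : BddBelow S := ⟨0, fun x hx => hx.1⟩
  set u := sInf S with hu
  have huS : u ∈ S := hSc.csInf_mem ⟨t, ht.le, hneg⟩ hSb
  have hu0 : 0 < u := by
    rcases huS.1.lt_or_eq with h | h
    · exact h
    · exfalso; have := huS.2; rw [← h] at this; linarith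
  have hHpos : ∀ x, 0 ≤ x → x < u → 0 < H x := by
    intro x hx hxu
    by_contra h
    push Not at h
    exact absurd (csInf_le hSb (show x ∈ S from ⟨hx, h⟩)) (not_le.2 hxu)
  have hWpos : ∀ x, 0 < x → x < u → 0 < W β β x := by
    intro x hx hxu
    rw [hW]; have := hHpos x hx.le hxu; positivity
  have hWu : W β β u ≤ 0 := by
    rw [hW]; exact mul_nonpos_of_nonneg_of_nonpos (by positivity) huS.2
  have hlim : Tendsto (fun x : ℝ => (u - x) ^ β / β) (𝓝[<] u) (𝓝 0) := by
    have hc : Continuous (fun x : ℝ => (u - x) ^ β / β) :=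
      ((Real.continuous_rpow_const hβ.le).comp (by fun_prop : Continuous fun x : ℝ => u - x)).div_const β
    have := (hc.tendsto u).mono_left (nhdsWithin_le_nhds (s := Set.Iio u))
    simpa [Real.zero_rpow hβ.ne'] using this
  have hev1 := hlim.eventually (gt_mem_nhds (show (0:ℝ) < Real.Gamma β / 2 by positivity))
  have hev2 : ∀ᶠ x in 𝓝[<] u, x ∈ Set.Ioo (u / 2) u :=
    Ioo_mem_nhdsLT (by linarith)
  obtain ⟨t₁, h1, h2⟩ := (hev1.and hev2).exists
  have hcont : ContinuousOn (W β β) (Set.Icc t₁ u) := by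
    intro x hx
    have hx0 : 0 < x := by linarith [hx.1, h2.1]
    have : ContinuousAt (W β β) x :=
      (Real.continuousAt_rpow_const x (β - 1) (Or.inl hx0.ne')).mul hHc.continuousAt
    exact this.continuousWithinAt
  obtain ⟨v, hv, hmax⟩ := isCompact_Icc.exists_isMaxOn ⟨t₁, le_refl _, h2.2.le⟩ hcont
  have ht₁pos : 0 < W β β t₁ := hWpos t₁ (by linarith [h2.1]) h2.2
  have hvpos : 0 < W β β v :=
    lt_of_lt_of_le ht₁pos (hmax (show t₁ ∈ Set.Icc t₁ u from ⟨le_refl _, h2.2.le⟩))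
  have hvu : v < u := by
    rcases hv.2.lt_or_eq with h | h
    · exact h
    · rw [h] at hvpos; linarith
  have hv0 : 0 < v := by linarith [hv.1, h2.1]
  have hI := conv_int hβ hβ hβ hu0
  have hIv := conv_int hβ hβ hβ hv0
  have hmem : v ∈ Set.uIcc 0 u := by rw [Set.uIcc_of_le hu0.le]; exact ⟨hv0.le, hvu.le⟩
  have hI1 : IntervalIntegrable (fun x : ℝ => (u - x) ^ (β - 1) * W β β x) volume 0 v :=
    hI.mono_set (Set.uIcc_subset_uIcc Set.left_mem_uIcc hmem)
  have hI2 : IntervalIntegrable (fun x : ℝ => (u - x) ^ (β - 1) * W β β x) volume v u :=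
    hI.mono_set (Set.uIcc_subset_uIcc hmem Set.right_mem_uIcc)
  have hsplit := intervalIntegral.integral_add_adjacent_intervals hI1 hI2
  rw [conv_r hβ hu0] at hsplit
  have b1 : ∫ x in (0:ℝ)..v, (u - x) ^ (β - 1) * W β β x ≤
      ∫ x in (0:ℝ)..v, (u / v) ^ (β - 1) * ((v - x) ^ (β - 1) * W β β x) := by
    apply intervalIntegral.integral_mono_on_of_le_Ioo hv0.le hI1 (hIv.const_mul _)
    intro x hx
    have hx1 : 0 < v - x := by linarith [hx.2]
    have hWx := hWpos x hx.1 (hx.2.trans hvu)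
    rw [← mul_assoc, ← Real.mul_rpow (by positivity) hx1.le]
    apply mul_le_mul_of_nonneg_right _ hWx.le
    apply Real.rpow_le_rpow_of_nonpos (by positivity) _ (by linarith)
    rw [div_mul_eq_mul_div, div_le_iff₀ hv0]
    nlinarith [hx.1]
  have b2 : ∫ x in v..u, (u - x) ^ (β - 1) * W β β x ≤
      ∫ x in v..u, (u - x) ^ (β - 1) * W β β v := by
    apply intervalIntegral.integral_mono_on_of_le_Ioo hvu.le hI2 ((ker_int hβ hvu).mul_const _)
    intro x hx
    apply mul_le_mul_of_nonneg_left _ (Real.rpow_nonneg (by linarith [hx.2]) _)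
    exact hmax (show x ∈ Set.Icc t₁ u from ⟨by linarith [hv.1, hx.1], hx.2.le⟩)
  rw [intervalIntegral.integral_const_mul, conv_r hβ hv0, mul_sub,
    ← Real.mul_rpow (by positivity) hv0.le, div_mul_cancel₀ _ hv0.ne'] at b1
  rw [intervalIntegral.integral_mul_const, ker_eq hβ] at b2
  have b3 : (u - v) ^ β / β ≤ (u - t₁) ^ β / β := by
    gcongr
    · exact hv.1
  have b4 : (1:ℝ) / 2 ≤ (u / v) ^ (β - 1) := by
    have huv : 1 ≤ u / v := by rw [le_div_iff₀ hv0]; linarith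
    have huv2 : u / v ≤ 2 := by rw [div_le_iff₀ hv0]; linarith [hv.1, h2.1]
    calc (1:ℝ) / 2 = (2:ℝ) ^ (-1 : ℝ) := by rw [Real.rpow_neg_one]; norm_num
      _ ≤ (u / v) ^ (-1 : ℝ) :=
        Real.rpow_le_rpow_of_nonpos (by linarith) huv2 (by norm_num)
      _ ≤ _ := Real.rpow_le_rpow_of_exponent_le huv (by linarith)
  have b5 : (u / v) ^ (β - 1) * (Real.Gamma β * W β β v) ≤ (u - v) ^ β / β * W β β v := by
    have : Real.Gamma β * W β β u ≤ 0 := mul_nonpos_of_nonneg_of_nonpos hΓ.le hWu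
    linarith
  have b6 : (1 / 2) * (Real.Gamma β * W β β v) ≤ (u / v) ^ (β - 1) * (Real.Gamma β * W β β v) :=
    mul_le_mul_of_nonneg_right b4 (by positivity)
  have b7 : (u - v) ^ β / β * W β β v < Real.Gamma β / 2 * W β β v :=
    mul_lt_mul_of_pos_right (by linarith) hvpos
  linarith

lemma f_eq {β t : ℝ} (hβ : 0 < β) (ht : 0 < t) :
    1 - W β 1 t = ∫ x in (0:ℝ)..t, W β β x := by
  have h := conv_eq hβ one_pos hβ ht
  simp only [sub_self, Real.rpow_zero, one_mul, Real.Gamma_one] at h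
  rw [h, W_rec hβ one_pos ht, add_comm β 1]
  simp

lemma r_int {β t : ℝ} (hβ : 0 < β) (ht : 0 < t) :
    IntervalIntegrable (W β β) volume 0 t := by
  have h := conv_int hβ one_pos hβ ht
  simpa only [sub_self, Real.rpow_zero, one_mul] using h

lemma f_anti {β s t : ℝ} (hβ : 0 < β) (hβ1 : β < 1) (hs : 0 < s) (hst : s ≤ t) :
    W β 1 t ≤ W β 1 s := by
  have ht : 0 < t := by linarith
  have h1 := f_eq hβ hs
  have h2 := f_eq hβ ht
  have hm : s ∈ Set.uIcc 0 t := by rw [Set.uIcc_of_le ht.le]; exact ⟨hs.le, hst⟩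
  have h3 := intervalIntegral.integral_add_adjacent_intervals (r_int hβ hs)
    ((r_int hβ ht).mono_set (Set.uIcc_subset_uIcc hm Set.right_mem_uIcc))
  have h4 : 0 ≤ ∫ x in s..t, W β β x :=
    intervalIntegral.integral_nonneg hst fun x hx => (W_pos hβ hβ1 (by linarith [hx.1])).le
  linarith

lemma upper {β t : ℝ} (hβ : 0 < β) (hβ1 : β < 1) (ht : 0 < t) :
    W β 1 t * (t ^ β / Real.Gamma (1 + β)) ≤ 1 - W β 1 t := by
  have hΓ : 0 < Real.Gamma β := Real.Gamma_pos_of_pos hβ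
  have h := conv_eq hβ hβ one_pos ht
  have h1 : W β 1 t = 1 - W β (1 + β) t := by rw [W_rec hβ one_pos ht]; simp
  have h2 : ∫ x in (0:ℝ)..t, (t - x) ^ (β - 1) * W β 1 t ≤
      ∫ x in (0:ℝ)..t, (t - x) ^ (β - 1) * W β 1 x := by
    apply intervalIntegral.integral_mono_on_of_le_Ioo ht.le ((ker_int hβ ht).mul_const _)
      (conv_int hβ hβ one_pos ht)
    intro x hx
    exact mul_le_mul_of_nonneg_left (f_anti hβ hβ1 hx.1 hx.2.le)
      (Real.rpow_nonneg (by linarith [hx.2]) _)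
  rw [h, intervalIntegral.integral_mul_const, ker_eq hβ, sub_zero] at h2
  rw [add_comm 1 β, Real.Gamma_add_one hβ.ne', show 1 - W β 1 t = W β (1 + β) t by linarith]
  have h3 : W β 1 t * (t ^ β / (β * Real.Gamma β)) = (t ^ β / β * W β 1 t) / Real.Gamma β := by
    field_simp
  rw [h3, div_le_iff₀ hΓ]; linarith

lemma lower {β t : ℝ} (hβ : 0 < β) (hβ1 : β < 1) (ht : 0 < t) :
    t ^ (-β) * (1 - W β 1 t) ≤ Real.Gamma (1 - β) * W β 1 t := by
  have hb : 0 < 1 - β := by linarith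
  have h := conv_eq hβ hb hβ ht
  rw [show β + (1 - β) = 1 by ring, show 1 - β - 1 = -β by ring] at h
  have hi := conv_int hβ hb hβ ht
  rw [show 1 - β - 1 = -β by ring] at hi
  rw [← h, f_eq hβ ht, ← intervalIntegral.integral_const_mul]
  apply intervalIntegral.integral_mono_on_of_le_Ioo ht.le ((r_int hβ ht).const_mul _) hi
  intro x hx
  apply mul_le_mul_of_nonneg_right _ (W_pos hβ hβ1 hx.1).le
  exact Real.rpow_le_rpow_of_nonpos (by linarith [hx.2]) (by linarith [hx.1]) (by linarith)

end MLAux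

/-- For `β ∈ (0,1)` and `s ≥ 0`, the two-sided bound
`1/(1 + Γ(1−β)·s) ≤ E_β(−s) ≤ 1/(1 + s/Γ(1+β))`. -/
theorem mittagLeffler_two_sided_bound (β : ℝ) (hβ : β ∈ Set.Ioo (0 : ℝ) 1)
    (s : ℝ) (hs : 0 ≤ s) :
    1 / (1 + Real.Gamma (1 - β) * s) ≤ mittagLeffler β (-s) ∧
      mittagLeffler β (-s) ≤ 1 / (1 + s / Real.Gamma (1 + β)) := by
  obtain ⟨hβ0, hβ1⟩ := hβ
  have hE : mittagLeffler β (-s) = MLAux.mlG β 1 s := by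
    unfold mittagLeffler MLAux.mlG
    simp_rw [add_comm]
  rw [hE]
  rcases hs.eq_or_lt with h0 | hs
  · rw [← h0, MLAux.mlG_zero]; simp
  have hΓ1 : 0 < Real.Gamma (1 - β) := Real.Gamma_pos_of_pos (by linarith)
  have hΓ2 : 0 < Real.Gamma (1 + β) := Real.Gamma_pos_of_pos (by linarith)
  set t : ℝ := s ^ (1 / β) with htdef
  have ht : 0 < t := Real.rpow_pos_of_pos hs _
  have hts : t ^ β = s := by
    rw [htdef, ← Real.rpow_mul hs.le]; field_simp; simp
  have hW : MLAux.W β 1 t = MLAux.mlG β 1 s := by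
    unfold MLAux.W; rw [hts]; simp
  have hu := MLAux.upper hβ0 hβ1 ht
  have hl := MLAux.lower hβ0 hβ1 ht
  rw [Real.rpow_neg ht.le] at hl
  rw [hts, hW] at hu hl
  constructor
  · rw [div_le_iff₀ (by positivity)]
    have : s * (s⁻¹ * (1 - MLAux.mlG β 1 s)) ≤ s * (Real.Gamma (1 - β) * MLAux.mlG β 1 s) :=
      mul_le_mul_of_nonneg_left hl hs.le
    rw [mul_inv_cancel_left₀ hs.ne'] at this
    linarith
  · rw [le_div_iff₀ (by positivity)]
    linarith
end

section
/- Fix κ ∈ (0,1), w > 0, and set c_1(κ) = 2^{(1−κ)/2}/(√π Γ(κ/2)). Define f_{κ,w}(λ) = (c_1(κ)/2)(K_{(κ−1)/2}(|λ+w|)|λ+w|^{(κ−1)/2} + K_{(κ−1)/2}(|λ−w|)|λ−w|^{(κ−1)/2}). Then f_{κ,w}(λ) is asymptotically equivalent, as |λ| → ∞, to (√π c_1(κ)(e^w + e^{−w})/2^{3/2}) · e^{−|λ|} |λ|^{κ/2−1}; that is, the ratio of the two expressions tends to 1. -/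
open Real Filter Topology

/-- The modified Bessel function of the second kind
`K_ν(z) = (1/2) ∫_0^∞ s^{ν−1} exp(−(z/2)(s + 1/s)) ds`. -/
noncomputable def besselK (ν z : ℝ) : ℝ :=
  (1 / 2) * ∫ s in Set.Ioi (0 : ℝ), s ^ (ν - 1) * Real.exp (-(z / 2) * (s + 1 / s))

/-- `c_1(κ) = 2^{(1−κ)/2}/(√π Γ(κ/2))`. -/
noncomputable def cOne (κ : ℝ) : ℝ :=
  (2 : ℝ) ^ ((1 - κ) / 2) / (Real.sqrt Real.pi * Real.Gamma (κ / 2))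

/-- The spectral density component
`f_{κ,w}(λ) = (c_1(κ)/2)(K_{(κ−1)/2}(|λ+w|)|λ+w|^{(κ−1)/2} + K_{(κ−1)/2}(|λ−w|)|λ−w|^{(κ−1)/2})`. -/
noncomputable def fkw (κ w lam : ℝ) : ℝ :=
  cOne κ / 2 *
    (besselK ((κ - 1) / 2) |lam + w| * |lam + w| ^ ((κ - 1) / 2) +
      besselK ((κ - 1) / 2) |lam - w| * |lam - w| ^ ((κ - 1) / 2))

lemma bess_sub (ν t : ℝ) (ht : 0 < t) :
    besselK ν ((t⁻¹) ^ 2) * exp ((t⁻¹) ^ 2) * t⁻¹ =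
      1 / 2 * ∫ v : ℝ, exp (ν * (v * t)) * exp (-2 * (t⁻¹ * sinh (v * t / 2)) ^ 2) := by
  have himg : (fun v : ℝ => exp (v * t)) '' Set.univ = Set.Ioi 0 := by
    ext s
    simp only [Set.image_univ, Set.mem_range, Set.mem_Ioi]
    constructor
    · rintro ⟨v, rfl⟩; exact exp_pos _
    · intro hs
      exact ⟨log s / t, by rw [div_mul_cancel₀ _ ht.ne', exp_log hs]⟩
  have hd : ∀ x ∈ (Set.univ : Set ℝ),
      HasDerivWithinAt (fun v : ℝ => exp (v * t)) (exp (x * t) * t) Set.univ x := by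
    intro x _
    have := ((hasDerivAt_id x).mul_const t).exp
    simpa using this
  have hinj : Set.InjOn (fun v : ℝ => exp (v * t)) Set.univ := by
    intro x _ y _ h
    have := exp_injective h
    exact mul_right_cancel₀ ht.ne' this
  unfold besselK
  rw [← himg, MeasureTheory.integral_image_eq_integral_abs_deriv_smul MeasurableSet.univ hd hinj,
    MeasureTheory.setIntegral_univ, mul_assoc, mul_assoc, ← MeasureTheory.integral_mul_const]
  congr 1
  congr 1
  ext v
  rw [abs_of_pos (by positivity), smul_eq_mul, ← exp_mul, one_div, ← Real.exp_neg]
  have h2 : exp (v * t) + exp (-(v * t)) = 2 + 4 * sinh (v * t / 2) ^ 2 := by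
    have := Real.cosh_eq (v * t)
    have h3 := Real.cosh_two_mul (v * t / 2)
    rw [Real.cosh_sq, show 2 * (v * t / 2) = v * t by ring] at h3
    linarith
  rw [h2]
  have : exp (v * t) * t * (exp (v * t * (ν - 1)) * exp (-(t⁻¹ ^ 2 / 2) * (2 + 4 * sinh (v * t / 2) ^ 2))) * (exp (t⁻¹ ^ 2) * t⁻¹)
     = (t * t⁻¹) * (exp (v * t) * exp (v * t * (ν - 1)) * exp (-(t⁻¹ ^ 2 / 2) * (2 + 4 * sinh (v * t / 2) ^ 2)) * exp (t⁻¹ ^ 2)) := by ring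
  rw [this, mul_inv_cancel₀ ht.ne', one_mul]
  simp only [← Real.exp_add]
  congr 1
  ring

lemma abs_le_abs_sinh (x : ℝ) : |x| ≤ |sinh x| := by
  rw [Real.abs_sinh]
  exact Real.self_le_sinh_iff.2 (abs_nonneg x)

lemma bess_lim0 (ν : ℝ) :
    Tendsto (fun t : ℝ => ∫ v : ℝ, exp (ν * (v * t)) * exp (-2 * (t⁻¹ * sinh (v * t / 2)) ^ 2))
      (𝓝[>] 0) (𝓝 (∫ v : ℝ, exp (-(1/2) * v ^ 2))) := by
  apply MeasureTheory.tendsto_integral_filter_of_dominated_convergence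
    (fun v => exp (ν ^ 2) * exp (-(1/4) * v ^ 2))
  · refine Eventually.of_forall fun t => ?_
    apply Continuous.aestronglyMeasurable
    have := Real.continuous_sinh
    fun_prop
  · have : Set.Ioo (0:ℝ) 1 ∈ 𝓝[>] (0:ℝ) := Ioo_mem_nhdsGT one_pos
    filter_upwards [this] with t ht
    refine Eventually.of_forall fun v => ?_
    rw [Real.norm_eq_abs, abs_of_pos (by positivity), ← Real.exp_add, ← Real.exp_add]
    apply Real.exp_le_exp.2
    have h1 := abs_le_abs_sinh (v * t / 2)
    have h2 : (v / 2) ^ 2 ≤ (t⁻¹ * sinh (v * t / 2)) ^ 2 := by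
      rw [show v / 2 = t⁻¹ * (v * t / 2) by field_simp [ht.1.ne'], mul_pow, mul_pow]
      exact mul_le_mul_of_nonneg_left (sq_le_sq.2 h1) (by positivity)
    have h3 : ν * (v * t) ≤ ν ^ 2 + (1/4) * v ^ 2 := by
      have h5 : (v * t) ^ 2 ≤ v ^ 2 := by
        rw [mul_pow]
        have : t ^ 2 ≤ 1 := by nlinarith [ht.1, ht.2]
        nlinarith [sq_nonneg v]
      nlinarith [sq_nonneg (ν - v * t / 2)]
    linarith
  · exact (integrable_exp_neg_mul_sq (by norm_num)).const_mul _
  · refine Eventually.of_forall fun v => ?_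
    have hd : HasDerivAt (fun t : ℝ => sinh (v * t / 2)) (v / 2) 0 := by
      have := (((hasDerivAt_id (0:ℝ)).const_mul v).div_const 2).sinh
      simpa using this
    have h1 := hd.tendsto_slope_zero_right
    simp only [zero_add, mul_zero, zero_div, Real.sinh_zero, sub_zero, smul_eq_mul] at h1
    have h2 : Tendsto (fun t : ℝ => exp (ν * (v * t))) (𝓝[>] 0) (𝓝 1) := by
      have : ContinuousAt (fun t : ℝ => exp (ν * (v * t))) 0 := by fun_prop
      have := this.tendsto.mono_left (nhdsWithin_le_nhds (s := Set.Ioi 0))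
      simpa using this
    have h3 := h2.mul ((Real.continuous_exp.tendsto _).comp ((h1.pow 2).const_mul (-2)))
    have h4 : exp (-(1/2) * v ^ 2) = 1 * exp (-2 * (v / 2) ^ 2) := by
      rw [one_mul]; congr 1; ring
    rw [h4]
    exact h3

lemma bess_lim (ν : ℝ) :
    Tendsto (fun z : ℝ => besselK ν z * exp z * z ^ (1/2 : ℝ)) atTop (𝓝 (1 / 2 * sqrt (2 * π))) := by
  have h0 := (bess_lim0 ν).const_mul (1/2)
  rw [integral_gaussian] at h0
  have hz : Tendsto (fun z : ℝ => (sqrt z)⁻¹) atTop (𝓝[>] 0) :=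
    tendsto_inv_atTop_nhdsGT_zero.comp Real.tendsto_sqrt_atTop
  have h1 := h0.comp hz
  rw [show π / (1 / 2) = 2 * π by ring] at h1
  refine h1.congr' ?_
  filter_upwards [eventually_gt_atTop 0] with z hz
  have := bess_sub ν (sqrt z)⁻¹ (by positivity)
  simp only [inv_inv, Real.sq_sqrt hz.le] at this
  simp only [Function.comp, inv_inv]
  rw [← this, Real.sqrt_eq_rpow]

lemma term_lim (κ a : ℝ) :
    Tendsto (fun l : ℝ => besselK ((κ - 1) / 2) |l + a| * |l + a| ^ ((κ - 1) / 2) /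
        (exp (-|l|) * |l| ^ (κ / 2 - 1))) atTop
      (𝓝 (1 / 2 * sqrt (2 * π) * exp (-a))) := by
  have h1 : Tendsto (fun l : ℝ => l + a) atTop atTop := tendsto_atTop_add_const_right _ _ tendsto_id
  have h2 := (bess_lim ((κ - 1) / 2)).comp h1
  have h3 : Tendsto (fun l : ℝ => (l + a) / l) atTop (𝓝 1) := by
    have : Tendsto (fun l : ℝ => 1 + a / l) atTop (𝓝 (1 + 0)) :=
      tendsto_const_nhds.add (tendsto_const_nhds.div_atTop tendsto_id)
    rw [add_zero] at this
    refine this.congr' ?_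
    filter_upwards [eventually_gt_atTop 0] with l hl
    field_simp
  have h4 := h3.rpow_const (p := κ / 2 - 1) (Or.inl one_ne_zero)
  rw [Real.one_rpow] at h4
  have h5 := (h2.mul_const (exp (-a))).mul h4
  rw [mul_one] at h5
  refine h5.congr' ?_
  filter_upwards [eventually_gt_atTop 0, h1.eventually_gt_atTop 0] with l hl hla
  simp only [Function.comp]
  rw [abs_of_pos hl, abs_of_pos hla, Real.div_rpow hla.le hl.le,
    show (κ - 1) / 2 = 1 / 2 + (κ / 2 - 1) by ring, Real.rpow_add hla, Real.exp_add,
    Real.exp_neg, Real.exp_neg]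
  have := Real.exp_ne_zero l
  have := Real.exp_ne_zero a
  have := (Real.rpow_pos_of_pos hl (κ / 2 - 1)).ne'
  field_simp

lemma fkw_neg (κ w l : ℝ) : fkw κ w (-l) = fkw κ w l := by
  unfold fkw
  rw [show -l + w = -(l - w) by ring, show -l - w = -(l + w) by ring, abs_neg, abs_neg]
  ring

/-- As `|λ| → ∞`, `f_{κ,w}(λ)` is asymptotically equivalent to
`(√π c_1(κ)(e^w + e^{−w})/2^{3/2}) e^{−|λ|} |λ|^{κ/2−1}`: their ratio tends to `1`. -/
theorem fkw_asymptotics (κ : ℝ) (hκ : κ ∈ Set.Ioo (0 : ℝ) 1) (w : ℝ) (hw : 0 < w) :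
    Filter.Tendsto
      (fun lam : ℝ =>
        fkw κ w lam /
          (Real.sqrt Real.pi * cOne κ * (Real.exp w + Real.exp (-w)) / (2 : ℝ) ^ ((3 : ℝ) / 2) *
            (Real.exp (-|lam|) * |lam| ^ (κ / 2 - 1))))
      (Filter.cocompact ℝ) (𝓝 1) := by
  have hc : cOne κ ≠ 0 := by
    have := Real.Gamma_pos_of_pos (show 0 < κ / 2 by linarith [hκ.1])
    unfold cOne
    positivity
  have htop : Filter.Tendsto
      (fun lam : ℝ =>
        fkw κ w lam /
          (Real.sqrt Real.pi * cOne κ * (Real.exp w + Real.exp (-w)) / (2 : ℝ) ^ ((3 : ℝ) / 2) *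
            (Real.exp (-|lam|) * |lam| ^ (κ / 2 - 1))))
      atTop (𝓝 1) := by
    have h := ((term_lim κ w).add (term_lim κ (-w))).const_mul (cOne κ / 2 /
      (Real.sqrt Real.pi * cOne κ * (Real.exp w + Real.exp (-w)) / (2 : ℝ) ^ ((3 : ℝ) / 2)))
    have h2 : (2 : ℝ) ^ ((3 : ℝ) / 2) = 2 * sqrt 2 := by
      rw [show (3 : ℝ) / 2 = 1 + 1 / 2 by norm_num, Real.rpow_add two_pos, Real.rpow_one,
        Real.sqrt_eq_rpow]
    convert h using 2
    · unfold fkw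
      rw [← sub_eq_add_neg, ← add_div, div_mul_div_comm]
    · rw [neg_neg, h2, Real.sqrt_mul two_pos.le]
      have hs : sqrt 2 * sqrt 2 = 2 := Real.mul_self_sqrt two_pos.le
      have hp : sqrt π ≠ 0 := by positivity
      have he : exp w + exp (-w) ≠ 0 := by positivity
      rw [show 1 / 2 * (sqrt 2 * sqrt π) * exp (-w) + 1 / 2 * (sqrt 2 * sqrt π) * exp w
        = 1 / 2 * (sqrt 2 * sqrt π) * (exp w + exp (-w)) by ring]
      generalize exp w + exp (-w) = E at *
      field_simp
      linarith
  rw [cocompact_eq_atBot_atTop, tendsto_sup]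
  refine ⟨?_, htop⟩
  refine (htop.comp tendsto_neg_atBot_atTop).congr fun l => ?_
  simp only [Function.comp, fkw_neg, abs_neg]
end

section
/- Let β ∈ (0,1), μ > 0, t > 0, α > 0. The integral ∫_ℝ E_β²(−μ t^β |λ|^α) dλ is finite if and only if α > 1/2. -/
open Real Filter Topology MeasureTheory

theorem ml_gamma_lower {y R : ℝ} (hy : 0 ≤ y) (hR : 0 < R) :
    R ^ y * Real.exp (-R) ≤ Real.Gamma (1 + y) := by
  have h1 : (0:ℝ) < 1 + y := by linarith
  rw [Real.Gamma_eq_integral h1, ← integral_exp_neg_Ioi, ← integral_const_mul]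
  have hInt := Real.GammaIntegral_convergent h1
  have hsub : Set.Ioi R ⊆ Set.Ioi 0 := Set.Ioi_subset_Ioi hR.le
  calc ∫ x in Set.Ioi R, R ^ y * Real.exp (-x)
      ≤ ∫ x in Set.Ioi R, Real.exp (-x) * x ^ (1 + y - 1) := by
        refine setIntegral_mono_on ?_ (hInt.mono_set hsub) measurableSet_Ioi ?_
        · exact (integrableOn_exp_neg_Ioi R).const_mul _
        · intro x hx
          have hx' : R < x := hx
          rw [mul_comm, add_sub_cancel_left]
          gcongr
    _ ≤ _ := by
        refine setIntegral_mono_set hInt ?_ hsub.eventuallyLE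
        refine (ae_restrict_iff' measurableSet_Ioi).mpr (Eventually.of_forall fun x hx => ?_)
        have hx' : (0:ℝ) < x := hx
        simp only [Pi.zero_apply]
        positivity

theorem ml_summable {β : ℝ} (hβ : 0 < β) {x : ℝ} (hx : 0 ≤ x) :
    Summable (fun k : ℕ => x ^ k / Real.Gamma (1 + β * k)) := by
  set R : ℝ := (2 * x + 1) ^ (1 / β) with hR
  have hRpos : 0 < R := by positivity
  have hRβ : R ^ β = 2 * x + 1 := by
    rw [hR, ← Real.rpow_mul (by positivity)]
    field_simp
    simp
  have hq : x / (2 * x + 1) < 1 := by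
    rw [div_lt_one (by positivity)]; linarith
  refine Summable.of_nonneg_of_le (fun k => ?_) (fun k => ?_)
    ((summable_geometric_of_lt_one (by positivity) hq).mul_left (Real.exp R))
  · have : 0 < Real.Gamma (1 + β * k) := Real.Gamma_pos_of_pos (by positivity)
    positivity
  · have hg : 0 < Real.Gamma (1 + β * k) := Real.Gamma_pos_of_pos (by positivity)
    have h := ml_gamma_lower (y := β * k) (by positivity) hRpos
    rw [Real.rpow_mul hRpos.le, hRβ, Real.rpow_natCast, Real.exp_neg] at h
    rw [div_le_iff₀ hg, div_pow]
    have he := Real.exp_pos R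
    calc x ^ k = Real.exp R * (x ^ k / (2 * x + 1) ^ k) * ((2 * x + 1) ^ k * (Real.exp R)⁻¹) := by
          field_simp
      _ ≤ _ := by gcongr

theorem ml_bernoulli {p s t : ℝ} (hp : 0 < p) (hs : 0 ≤ s) (hst : s ≤ t) (ht : 0 < t) :
    t ^ p - s ^ p ≤ (1 + p) * t ^ (p - 1) * (t - s) := by
  have key : ∀ x : ℝ, 0 ≤ x → x ≤ 1 → 1 - x ^ p ≤ (1 + p) * (1 - x) := by
    intro x h0 h1
    rcases le_total 1 p with h | h
    · have := one_add_mul_self_le_rpow_one_add (s := x - 1) (by linarith) h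
      rw [add_sub_cancel] at this
      nlinarith
    · have : x ^ (1:ℝ) ≤ x ^ p := by
        rcases h0.eq_or_lt with h0 | h0
        · subst h0
          rw [Real.zero_rpow (by norm_num), Real.zero_rpow hp.ne']
        · exact Real.rpow_le_rpow_of_exponent_ge h0 h1 h
      rw [Real.rpow_one] at this
      nlinarith
  have h := key (s / t) (by positivity) ((div_le_one ht).2 hst)
  rw [Real.div_rpow hs ht.le] at h
  rw [Real.rpow_sub_one ht.ne']
  have h2 := mul_le_mul_of_nonneg_left h (Real.rpow_nonneg ht.le p)
  have hp' := Real.rpow_pos_of_pos ht p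
  calc t ^ p - s ^ p = t ^ p * (1 - s ^ p / t ^ p) := by field_simp
    _ ≤ _ := h2
    _ = _ := by field_simp

theorem ml_beta {p q t : ℝ} (hp : 0 < p) (hq : 0 < q) (ht : 0 < t) :
    ∫ s in (0:ℝ)..t, s ^ (p - 1) * (t - s) ^ (q - 1) =
      t ^ (p + q - 1) * (Real.Gamma p * Real.Gamma q / Real.Gamma (p + q)) := by
  have h := Complex.betaIntegral_scaled p q ht
  rw [Complex.betaIntegral_eq_Gamma_mul_div _ _ (by simpa) (by simpa)] at h
  have h2 : ∫ s in (0:ℝ)..t, (s : ℂ) ^ ((p:ℂ) - 1) * ((t : ℂ) - s) ^ ((q:ℂ) - 1) =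
      ∫ s in (0:ℝ)..t, ((s ^ (p - 1) * (t - s) ^ (q - 1) : ℝ) : ℂ) := by
    refine intervalIntegral.integral_congr fun s hs => ?_
    rw [Set.uIcc_of_le ht.le] at hs
    have h3 : 0 ≤ t - s := sub_nonneg.2 hs.2
    rw [Complex.ofReal_mul, Complex.ofReal_cpow hs.1, Complex.ofReal_cpow h3]
    push_cast
    rfl
  rw [h2, intervalIntegral.integral_ofReal] at h
  apply Complex.ofReal_injective
  rw [h, Complex.ofReal_mul, Complex.ofReal_cpow ht.le]
  push_cast [Complex.Gamma_ofReal, ← Complex.ofReal_add]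
  rw [← Complex.Gamma_ofReal, ← Complex.Gamma_ofReal, ← Complex.Gamma_ofReal]

theorem ml_beta_int {p q t : ℝ} (hp : 0 < p) (hq : 0 < q) (ht : 0 < t) :
    IntervalIntegrable (fun s => s ^ (p - 1) * (t - s) ^ (q - 1)) volume 0 t := by
  apply intervalIntegral.intervalIntegrable_of_integral_ne_zero
  rw [ml_beta hp hq ht]
  have := Real.Gamma_pos_of_pos hp
  have := Real.Gamma_pos_of_pos hq
  have := Real.Gamma_pos_of_pos (add_pos hp hq)
  positivity

theorem ml_pow_int {β t : ℝ} (hβ1 : β < 1) :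
    IntervalIntegrable (fun s => (t - s) ^ (-β)) volume 0 t := by
  have := (intervalIntegral.intervalIntegrable_rpow' (a := t) (b := 0) (r := -β) (by linarith)).comp_sub_left t
  simpa using this

theorem ml_term_bound {β p s t : ℝ} (hp : 0 < p) (hs : 0 ≤ s) (hst : s < t) :
    |(t ^ p - s ^ p) * (t - s) ^ (-β - 1)| ≤ (1 + p) * t ^ (p - 1) * (t - s) ^ (-β) := by
  have ht : 0 < t := hs.trans_lt hst
  have h := ml_bernoulli hp hs hst.le ht
  have h0 : 0 ≤ t ^ p - s ^ p := sub_nonneg.2 (Real.rpow_le_rpow hs hst.le hp.le)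
  have hd : 0 < t - s := sub_pos.2 hst
  rw [abs_of_nonneg (by positivity), Real.rpow_sub_one hd.ne']
  calc _ ≤ (1 + p) * t ^ (p - 1) * (t - s) * ((t - s) ^ (-β) / (t - s)) := by gcongr
    _ = _ := by field_simp

/-- An integrability criterion by domination. -/
theorem ml_int_of_bound {β t C : ℝ} (hβ1 : β < 1) (ht : 0 < t) {F : ℝ → ℝ}
    (hF : ContinuousOn F (Set.Ioo 0 t))
    (h : ∀ s ∈ Set.Ioo 0 t, |F s| ≤ C * (t - s) ^ (-β)) :
    IntervalIntegrable F volume 0 t := by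
  have hi := (ml_pow_int (t := t) hβ1).const_mul C
  rw [intervalIntegrable_iff_integrableOn_Ioo_of_le ht.le] at hi ⊢
  refine Integrable.mono' hi (hF.aestronglyMeasurable measurableSet_Ioo) ?_
  exact (ae_restrict_iff' measurableSet_Ioo).mpr (Eventually.of_forall h)

theorem ml_term {β p t : ℝ} (hβ0 : 0 < β) (hβ1 : β < 1) (hp : 0 < p) (ht : 0 < t) :
    t ^ (p - β) + β * ∫ s in (0:ℝ)..t, (t ^ p - s ^ p) * (t - s) ^ (-β - 1) =
      t ^ (p - β) * (Real.Gamma (p + 1) * Real.Gamma (1 - β) / Real.Gamma (p + 1 - β)) := by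
  have hI1 : IntervalIntegrable (fun s => (t ^ p - s ^ p) * (t - s) ^ (-β - 1)) volume 0 t := by
    refine ml_int_of_bound hβ1 ht (C := (1 + p) * t ^ (p - 1)) ?_ ?_
    · intro s hs
      refine ContinuousAt.continuousWithinAt ?_
      have h1 : s ≠ 0 := hs.1.ne'
      have h2 : t - s ≠ 0 := (sub_pos.2 hs.2).ne'
      fun_prop (disch := simp [h1, h2])
    · exact fun s hs => ml_term_bound hp hs.1.le hs.2
  have hI2 : IntervalIntegrable (fun s => s ^ (p - 1) * (t - s) ^ (-β)) volume 0 t := by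
    have := ml_beta_int (q := 1 - β) hp (by linarith) ht
    simpa [show 1 - β - 1 = -β by ring] using this
  have hB : ∫ s in (0:ℝ)..t, s ^ (p - 1) * (t - s) ^ (-β) =
      t ^ (p - β) * (Real.Gamma p * Real.Gamma (1 - β) / Real.Gamma (p + 1 - β)) := by
    have := ml_beta (q := 1 - β) hp (by linarith) ht
    rw [show 1 - β - 1 = -β by ring, show p + (1 - β) - 1 = p - β by ring,
      show p + (1 - β) = p + 1 - β by ring] at this
    exact this
  have hF := intervalIntegral.integral_eq_sub_of_hasDerivAt_of_le (a := 0) (b := t)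
    (f := fun s => (t ^ p - s ^ p) * (t - s) ^ (-β))
    (f' := fun s => β * ((t ^ p - s ^ p) * (t - s) ^ (-β - 1)) -
      p * (s ^ (p - 1) * (t - s) ^ (-β))) ht.le ?_ ?_ ((hI1.const_mul β).sub (hI2.const_mul p))
  · rw [intervalIntegral.integral_sub (hI1.const_mul β) (hI2.const_mul p),
      intervalIntegral.integral_const_mul, intervalIntegral.integral_const_mul, hB] at hF
    simp only [sub_self, zero_mul, Real.zero_rpow hp.ne', sub_zero, zero_sub] at hF
    rw [← Real.rpow_add ht, ← sub_eq_add_neg] at hF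
    rw [Real.Gamma_add_one hp.ne']
    linear_combination hF
  · intro s hs
    rcases hs.2.eq_or_lt with h | h
    · subst h
      have hlim : Tendsto (fun u => (1 + p) * s ^ (p - 1) * (s - u) ^ (1 - β))
          (𝓝[Set.Icc 0 s] s) (𝓝 0) := by
        have : ContinuousAt (fun u => (1 + p) * s ^ (p - 1) * (s - u) ^ (1 - β)) s := by
          have : (0:ℝ) ≤ 1 - β := by linarith
          refine ContinuousAt.mul continuousAt_const ?_
          exact ContinuousAt.rpow_const (by fun_prop) (Or.inr this)
        have h2 := this.tendsto
        simp only [sub_self, Real.zero_rpow (show 1 - β ≠ 0 by linarith), mul_zero] at h2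
        exact h2.mono_left nhdsWithin_le_nhds
      unfold ContinuousWithinAt
      simp only [sub_self, zero_mul]
      refine squeeze_zero_norm' ?_ hlim
      filter_upwards [self_mem_nhdsWithin] with u hu
      rcases hu.2.eq_or_lt with h | h
      · subst h
        simp [Real.zero_rpow (show 1 - β ≠ 0 by linarith)]
      · have := ml_term_bound (β := β - 1) hp hu.1 h
        rw [show -(β - 1) - 1 = -β by ring, show -(β - 1) = 1 - β by ring] at this
        exact this
    · refine ContinuousAt.continuousWithinAt ?_
      have h2 : t - s ≠ 0 := (sub_pos.2 h).ne'
      have h3 : 0 ≤ p := hp.le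
      refine ContinuousAt.mul (continuousAt_const.sub (ContinuousAt.rpow_const continuousAt_id (Or.inr h3))) ?_
      exact ContinuousAt.rpow_const (by fun_prop) (Or.inl h2)
  · intro s hs
    have h1 : s ≠ 0 := hs.1.ne'
    have h2 : t - s ≠ 0 := (sub_pos.2 hs.2).ne'
    have d1 : HasDerivAt (fun s : ℝ => t ^ p - s ^ p) (-(p * s ^ (p - 1))) s := by
      simpa using (Real.hasDerivAt_rpow_const (x := s) (p := p) (Or.inl h1)).const_sub (t ^ p)
    have d2 : HasDerivAt (fun s : ℝ => (t - s) ^ (-β)) (-1 * (-β) * (t - s) ^ (-β - 1)) s :=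
      ((hasDerivAt_id s).const_sub t).rpow_const (Or.inl h2)
    exact (d1.mul d2).congr_deriv (by ring)

theorem ml_hasSum_congr {f g : ℕ → ℝ} {a : ℝ} (h : ∀ k, f k = g k) (hg : HasSum g a) :
    HasSum f a := by
  rwa [show f = g from funext h]

theorem ml_summable' {β : ℝ} (hβ : 0 < β) (x : ℝ) :
    Summable (fun k : ℕ => x ^ k / Real.Gamma (1 + β * k)) := by
  refine Summable.of_norm_bounded (ml_summable hβ (abs_nonneg x)) fun k => ?_
  have hg : 0 < Real.Gamma (1 + β * k) := Real.Gamma_pos_of_pos (by positivity)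
  rw [norm_div, norm_pow, Real.norm_eq_abs, Real.norm_eq_abs, abs_of_pos hg]

theorem ml_continuous {β : ℝ} (hβ : 0 < β) : Continuous (mittagLeffler β) := by
  rw [continuous_iff_continuousAt]
  intro x
  have h : ContinuousOn (mittagLeffler β) (Metric.ball 0 (|x| + 1)) := by
    refine continuousOn_tsum (fun k => by fun_prop)
      (ml_summable hβ (x := |x| + 1) (by positivity)) fun k y hy => ?_
    have hg : 0 < Real.Gamma (1 + β * k) := Real.Gamma_pos_of_pos (by positivity)
    rw [norm_div, norm_pow, Real.norm_eq_abs (Real.Gamma _), abs_of_pos hg]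
    have : ‖y‖ ≤ |x| + 1 := (mem_ball_zero_iff.1 hy).le
    gcongr
  exact h.continuousAt (Metric.isOpen_ball.mem_nhds (by simp))

/-- The relaxation function `t ↦ E_β(-t^β)`. -/
noncomputable def mlf (β t : ℝ) : ℝ := mittagLeffler β (-(t ^ β))

theorem mlf_continuous {β : ℝ} (hβ : 0 < β) : Continuous (mlf β) :=
  (ml_continuous hβ).comp (Real.continuous_rpow_const hβ.le).neg

theorem mlf_zero {β : ℝ} (hβ : 0 < β) : mlf β 0 = 1 := by
  unfold mlf mittagLeffler
  rw [Real.zero_rpow hβ.ne', tsum_eq_single 0]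
  · simp
  · intro k hk
    simp [hk]

theorem mlf_hasSum {β : ℝ} (hβ : 0 < β) {t : ℝ} (ht : 0 ≤ t) :
    HasSum (fun k : ℕ => (-1) ^ k / Real.Gamma (1 + β * k) * t ^ (β * k)) (mlf β t) := by
  have h := (ml_summable' hβ (-(t ^ β))).hasSum
  refine ml_hasSum_congr (fun k => ?_) h
  rw [Real.rpow_mul ht, Real.rpow_natCast, neg_pow]
  ring

theorem mlf_bound_summable {β : ℝ} (hβ : 0 < β) (hβ1 : β < 1) {t : ℝ} (ht : 0 < t) :
    Summable (fun k : ℕ => 1 / Real.Gamma (1 + β * k) * ((1 + β * k) * t ^ (β * k - 1))) := by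
  refine Summable.of_nonneg_of_le (fun k => ?_) (fun k => ?_)
    ((ml_summable hβ (x := 2 * t ^ β) (by positivity)).mul_left t⁻¹)
  · have hg : 0 < Real.Gamma (1 + β * k) := Real.Gamma_pos_of_pos (by positivity)
    positivity
  · have hg : 0 < Real.Gamma (1 + β * k) := Real.Gamma_pos_of_pos (by positivity)
    have h2 : 1 + β * k ≤ (2:ℝ) ^ k := by
      have := one_add_mul_le_pow (a := (1:ℝ)) (by norm_num) k
      norm_num at this
      have hk : (0:ℝ) ≤ k := by positivity
      nlinarith
    rw [Real.rpow_sub_one ht.ne', Real.rpow_mul ht.le, Real.rpow_natCast, mul_pow]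
    calc _ ≤ 1 / Real.Gamma (1 + β * k) * (2 ^ k * ((t ^ β) ^ k / t)) := by gcongr
      _ = _ := by field_simp

theorem mlf_termbound {β : ℝ} (hβ : 0 < β) {s t : ℝ} (hs : 0 ≤ s) (hst : s < t) (k : ℕ) :
    ‖(-1) ^ k / Real.Gamma (1 + β * k) * ((t ^ (β * k) - s ^ (β * k)) * (t - s) ^ (-β - 1))‖ ≤
      1 / Real.Gamma (1 + β * k) * ((1 + β * k) * t ^ (β * k - 1)) * (t - s) ^ (-β) := by
  have hg : 0 < Real.Gamma (1 + β * k) := Real.Gamma_pos_of_pos (by positivity)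
  have ht : 0 < t := hs.trans_lt hst
  have hd : 0 < t - s := sub_pos.2 hst
  rw [norm_mul, norm_div, norm_pow, norm_neg, norm_one, one_pow, Real.norm_eq_abs (Real.Gamma _),
    abs_of_pos hg, mul_assoc]
  refine mul_le_mul_of_nonneg_left ?_ (by positivity)
  rcases Nat.eq_zero_or_pos k with h | h
  · subst h
    simp
    positivity
  · exact ml_term_bound (by positivity) hs hst

theorem mlf_G_hasSum {β : ℝ} (hβ : 0 < β) {s t : ℝ} (hs : 0 ≤ s) (hst : s < t) :
    HasSum (fun k : ℕ => (-1) ^ k / Real.Gamma (1 + β * k) *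
      ((t ^ (β * k) - s ^ (β * k)) * (t - s) ^ (-β - 1)))
      ((mlf β t - mlf β s) * (t - s) ^ (-β - 1)) := by
  have h := ((mlf_hasSum hβ (hs.trans hst.le)).sub (mlf_hasSum hβ hs)).mul_right
    ((t - s) ^ (-β - 1))
  refine ml_hasSum_congr (fun k => ?_) h
  ring

theorem mlf_G_int {β : ℝ} (hβ : 0 < β) (hβ1 : β < 1) {t : ℝ} (ht : 0 < t) :
    IntervalIntegrable (fun s => (mlf β t - mlf β s) * (t - s) ^ (-β - 1)) volume 0 t := by
  refine ml_int_of_bound hβ1 ht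
    (C := ∑' k : ℕ, 1 / Real.Gamma (1 + β * k) * ((1 + β * k) * t ^ (β * k - 1))) ?_ ?_
  · intro s hs
    refine ContinuousAt.continuousWithinAt ?_
    have h2 : t - s ≠ 0 := (sub_pos.2 hs.2).ne'
    refine ContinuousAt.mul (continuousAt_const.sub (mlf_continuous hβ).continuousAt) ?_
    exact ContinuousAt.rpow_const (by fun_prop) (Or.inl h2)
  · intro s hs
    have hb := (mlf_bound_summable hβ hβ1 ht).hasSum.mul_right ((t - s) ^ (-β))
    rw [← (mlf_G_hasSum hβ hs.1.le hs.2).tsum_eq, ← Real.norm_eq_abs]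
    exact tsum_of_norm_bounded hb (mlf_termbound hβ hs.1.le hs.2)

theorem mlf_identity {β : ℝ} (hβ : 0 < β) (hβ1 : β < 1) {t : ℝ} (ht : 0 < t) :
    (mlf β t - 1) * t ^ (-β) + β * ∫ s in (0:ℝ)..t, (mlf β t - mlf β s) * (t - s) ^ (-β - 1) =
      -(Real.Gamma (1 - β) * mlf β t) := by
  have hI : HasSum (fun k : ℕ => ∫ s in (0:ℝ)..t, (-1) ^ k / Real.Gamma (1 + β * k) *
      ((t ^ (β * k) - s ^ (β * k)) * (t - s) ^ (-β - 1)))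
      (∫ s in (0:ℝ)..t, (mlf β t - mlf β s) * (t - s) ^ (-β - 1)) := by
    have hne : ∀ᵐ s : ℝ, s ≠ t := by
      simp [ae_iff, measure_singleton]
    refine intervalIntegral.hasSum_integral_of_dominated_convergence
      (fun k s => 1 / Real.Gamma (1 + β * k) * ((1 + β * k) * t ^ (β * k - 1)) * (t - s) ^ (-β))
      ?_ ?_ ?_ ?_ ?_
    · intro k
      refine Measurable.aestronglyMeasurable ?_
      fun_prop
    · intro k
      filter_upwards [hne] with s hs hm
      rw [Set.uIoc_of_le ht.le] at hm
      exact mlf_termbound hβ hm.1.le (lt_of_le_of_ne hm.2 hs) k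
    · filter_upwards with s hm
      exact (mlf_bound_summable hβ hβ1 ht).mul_right _
    · simp_rw [tsum_mul_right]
      exact (ml_pow_int hβ1).const_mul _
    · filter_upwards [hne] with s hs hm
      rw [Set.uIoc_of_le ht.le] at hm
      exact mlf_G_hasSum hβ hm.1.le (lt_of_le_of_ne hm.2 hs)
  have hI1 := (hasSum_nat_add_iff' 1).2 hI
  have hf1 := (hasSum_nat_add_iff' 1).2 (mlf_hasSum hβ ht.le)
  simp only [Finset.range_one, Finset.sum_singleton, Nat.cast_zero, mul_zero, Real.rpow_zero,
    sub_self, zero_mul, intervalIntegral.integral_zero, sub_zero, add_zero, Real.Gamma_one,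
    pow_zero, div_one, mul_one] at hI1 hf1
  have hL := (hf1.mul_right (t ^ (-β))).add (hI1.mul_left β)
  have hR := ((mlf_hasSum hβ ht.le).mul_left (Real.Gamma (1 - β))).neg
  refine hL.unique ?_
  refine ml_hasSum_congr (fun k => ?_) hR
  rw [intervalIntegral.integral_const_mul]
  have hp : 0 < β * ((k + 1 : ℕ) : ℝ) := by positivity
  have h := ml_term hβ hβ1 hp ht
  have e1 : β * ((k + 1 : ℕ) : ℝ) - β = β * k := by push_cast; ring
  have e2 : β * ((k + 1 : ℕ) : ℝ) + 1 - β = 1 + β * k := by push_cast; ring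
  have e3 : t ^ (β * ((k + 1 : ℕ) : ℝ)) * t ^ (-β) = t ^ (β * k) := by
    rw [← Real.rpow_add ht]; congr 1
  rw [e1, e2, add_comm _ (1:ℝ)] at h
  have hg1 : 0 < Real.Gamma (1 + β * k) := Real.Gamma_pos_of_pos (by positivity)
  have hg2 : 0 < Real.Gamma (1 + β * ((k + 1 : ℕ) : ℝ)) := Real.Gamma_pos_of_pos (by positivity)
  set g1 := Real.Gamma (1 + β * k)
  set g2 := Real.Gamma (1 + β * ((k + 1 : ℕ) : ℝ))
  calc _ = (-1) ^ (k + 1) / g2 * (t ^ (β * ((k + 1 : ℕ) : ℝ)) * t ^ (-β) +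
        β * ∫ s in (0:ℝ)..t, (t ^ (β * ((k + 1 : ℕ) : ℝ)) - s ^ (β * ((k + 1 : ℕ) : ℝ))) *
          (t - s) ^ (-β - 1)) := by ring
    _ = _ := by
      rw [e3, h]
      field_simp
      ring

theorem mlf_lower {β : ℝ} (hβ : 0 < β) (hβ1 : β < 1) {t : ℝ} (ht : 0 ≤ t) :
    1 / (1 + Real.Gamma (1 - β) * t ^ β) ≤ mlf β t := by
  have hG : 0 < Real.Gamma (1 - β) := Real.Gamma_pos_of_pos (by linarith)
  obtain ⟨r, hr, hmin⟩ := isCompact_Icc.exists_isMinOn (Set.nonempty_Icc.2 ht)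
    (mlf_continuous hβ).continuousOn
  have hrt : mlf β r ≤ mlf β t := hmin (Set.right_mem_Icc.2 ht)
  refine le_trans ?_ hrt
  rcases hr.1.eq_or_lt with h | h
  · rw [← h, mlf_zero hβ, div_le_one (by positivity)]
    have : 0 ≤ Real.Gamma (1 - β) * t ^ β := by positivity
    linarith
  · have hid := mlf_identity hβ hβ1 h
    have hInt : ∫ s in (0:ℝ)..r, (mlf β r - mlf β s) * (r - s) ^ (-β - 1) ≤ 0 := by
      rw [← neg_nonneg, ← intervalIntegral.integral_neg]
      refine intervalIntegral.integral_nonneg h.le fun s hs => ?_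
      have h1 : mlf β r ≤ mlf β s := hmin ⟨hs.1, hs.2.trans hr.2⟩
      have h2 : 0 ≤ (r - s) ^ (-β - 1) := Real.rpow_nonneg (sub_nonneg.2 hs.2) _
      nlinarith
    have h3 : (mlf β r - 1) * r ^ (-β) ≥ -(Real.Gamma (1 - β) * mlf β r) := by
      have := mul_nonneg_of_nonpos_of_nonpos hInt (neg_nonpos.2 hβ.le)
      nlinarith
    have hrp : 0 < r ^ β := by positivity
    rw [Real.rpow_neg h.le] at h3
    have h4 : 1 ≤ mlf β r * (1 + Real.Gamma (1 - β) * r ^ β) := by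
      have := mul_le_mul_of_nonneg_right h3 hrp.le
      rw [mul_assoc, inv_mul_cancel₀ hrp.ne'] at this
      nlinarith
    have h5 : r ^ β ≤ t ^ β := Real.rpow_le_rpow h.le hr.2 hβ.le
    calc 1 / (1 + Real.Gamma (1 - β) * t ^ β) ≤ 1 / (1 + Real.Gamma (1 - β) * r ^ β) := by gcongr
      _ ≤ _ := by rwa [div_le_iff₀ (by positivity)]

theorem mlf_pos {β : ℝ} (hβ : 0 < β) (hβ1 : β < 1) {t : ℝ} (ht : 0 ≤ t) : 0 < mlf β t := by
  have hG : 0 < Real.Gamma (1 - β) := Real.Gamma_pos_of_pos (by linarith)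
  exact lt_of_lt_of_le (by positivity) (mlf_lower hβ hβ1 ht)

theorem mlf_le_one {β : ℝ} (hβ : 0 < β) (hβ1 : β < 1) {t : ℝ} (ht : 0 ≤ t) : mlf β t ≤ 1 := by
  have hG : 0 < Real.Gamma (1 - β) := Real.Gamma_pos_of_pos (by linarith)
  obtain ⟨r, hr, hmax⟩ := isCompact_Icc.exists_isMaxOn (Set.nonempty_Icc.2 ht)
    (mlf_continuous hβ).continuousOn
  have hrt : mlf β t ≤ mlf β r := hmax (Set.right_mem_Icc.2 ht)
  refine le_trans hrt ?_
  rcases hr.1.eq_or_lt with h | h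
  · rw [← h, mlf_zero hβ]
  · have hid := mlf_identity hβ hβ1 h
    have hInt : 0 ≤ ∫ s in (0:ℝ)..r, (mlf β r - mlf β s) * (r - s) ^ (-β - 1) := by
      refine intervalIntegral.integral_nonneg h.le fun s hs => ?_
      have h1 : mlf β s ≤ mlf β r := hmax ⟨hs.1, hs.2.trans hr.2⟩
      have h2 : 0 ≤ (r - s) ^ (-β - 1) := Real.rpow_nonneg (sub_nonneg.2 hs.2) _
      exact mul_nonneg (by linarith) h2
    have hp := mul_pos hG (mlf_pos hβ hβ1 hr.1)
    have hq := mul_nonneg hβ.le hInt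
    by_contra! hc
    have : 0 ≤ (mlf β r - 1) * r ^ (-β) := mul_nonneg (by linarith) (by positivity)
    linarith

theorem mlf_upper {β : ℝ} (hβ : 0 < β) (hβ1 : β < 1) {t : ℝ} (ht : 0 ≤ t) :
    t ^ β * mlf β t ≤ (5 + 2 / (1 - β)) / Real.Gamma (1 - β) := by
  have hG : 0 < Real.Gamma (1 - β) := Real.Gamma_pos_of_pos (by linarith)
  have hb : 0 < 1 - β := by linarith
  obtain ⟨r, hr, hmax⟩ := isCompact_Icc.exists_isMaxOn (Set.nonempty_Icc.2 ht)
    ((Real.continuous_rpow_const hβ.le).mul (mlf_continuous hβ)).continuousOn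
  have hrt : t ^ β * mlf β t ≤ r ^ β * mlf β r := hmax (Set.right_mem_Icc.2 ht)
  refine le_trans hrt ?_
  rcases hr.1.eq_or_lt with h | h
  · rw [← h, Real.zero_rpow hβ.ne', zero_mul]
    positivity
  have hid := mlf_identity hβ hβ1 h
  have hfp := mlf_pos hβ hβ1 h.le
  have hf1 := mlf_le_one hβ hβ1 h.le
  have hrp : 0 < r ^ β := by positivity
  have hi := ml_pow_int (t := r) hβ1
  -- pointwise bound
  have hpt : ∀ s ∈ Set.Ioo 0 r, -((r / 2) ^ (-β - 1) + 2 * mlf β r / r * (r - s) ^ (-β)) ≤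
      (mlf β r - mlf β s) * (r - s) ^ (-β - 1) := by
    intro s hs
    have hd : 0 < r - s := sub_pos.2 hs.2
    have hs0 : 0 < s := hs.1
    have hsp := mlf_pos hβ hβ1 hs.1.le
    have hs1 := mlf_le_one hβ hβ1 hs.1.le
    have hdp : 0 < (r - s) ^ (-β - 1) := by positivity
    rcases le_total s (r / 2) with h2 | h2
    · have e1 : (r - s) ^ (-β - 1) ≤ (r / 2) ^ (-β - 1) :=
        Real.rpow_le_rpow_of_nonpos (by positivity) (by linarith) (by linarith)
      have e2 : 0 ≤ 2 * mlf β r / r * (r - s) ^ (-β) := by positivity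
      nlinarith
    · have e0 : 0 < (r / 2) ^ (-β - 1) := by positivity
      have hm : s ^ β * mlf β s ≤ r ^ β * mlf β r := hmax ⟨hs.1.le, hs.2.le.trans hr.2⟩
      have e1 : r ^ β / s ^ β ≤ r / s := by
        rw [← Real.div_rpow h.le hs0.le]
        calc (r / s) ^ β ≤ (r / s) ^ (1:ℝ) :=
              Real.rpow_le_rpow_of_exponent_le ((one_le_div hs0).2 hs.2.le) hβ1.le
          _ = _ := Real.rpow_one _
      have hsb : 0 < s ^ β := by positivity
      have e2 : mlf β s ≤ mlf β r * (r / s) := by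
        calc mlf β s ≤ mlf β r * (r ^ β / s ^ β) := by
              rw [← mul_div_assoc, le_div_iff₀ hsb]; linarith
          _ ≤ _ := by gcongr
      have e3 : r / s - 1 ≤ 2 / r * (r - s) := by
        rw [div_sub_one hs0.ne', div_mul_eq_mul_div, div_le_div_iff₀ hs0 h]
        nlinarith
      have e4 : mlf β s - mlf β r ≤ mlf β r * (2 / r * (r - s)) := by
        have := mul_le_mul_of_nonneg_left e3 hfp.le
        linarith
      have e5 := mul_le_mul_of_nonneg_right e4 hdp.le
      have e6 : mlf β r * (2 / r * (r - s)) * (r - s) ^ (-β - 1) =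
          2 * mlf β r / r * (r - s) ^ (-β) := by
        rw [Real.rpow_sub_one hd.ne']
        field_simp
      linarith
  have hInt : -((r / 2) ^ (-β - 1) * r + 2 * mlf β r / r * (r ^ (1 - β) / (1 - β))) ≤
      ∫ s in (0:ℝ)..r, (mlf β r - mlf β s) * (r - s) ^ (-β - 1) := by
    have e : ∫ s in (0:ℝ)..r, -((r / 2) ^ (-β - 1) + 2 * mlf β r / r * (r - s) ^ (-β)) =
        -((r / 2) ^ (-β - 1) * r + 2 * mlf β r / r * (r ^ (1 - β) / (1 - β))) := by
      rw [intervalIntegral.integral_neg, intervalIntegral.integral_add (by simp) (hi.const_mul _),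
        intervalIntegral.integral_const_mul,
        intervalIntegral.integral_comp_sub_left (fun x => x ^ (-β)),
        integral_rpow (Or.inl (by linarith))]
      simp only [intervalIntegral.integral_const, sub_self, sub_zero, smul_eq_mul]
      rw [show -β + 1 = 1 - β by ring, Real.zero_rpow hb.ne']
      ring
    rw [← e]
    refine intervalIntegral.integral_mono_on_of_le_Ioo h.le ?_ (mlf_G_int hβ hβ1 h) hpt
    exact (IntervalIntegrable.add (by simp) (hi.const_mul _)).neg
  have e1 : (r / 2) ^ (-β - 1) * r * r ^ β ≤ 4 := by
    rw [Real.div_rpow h.le (by norm_num), Real.rpow_sub_one h.ne', Real.rpow_neg h.le]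
    have : ((2:ℝ) ^ (-β - 1))⁻¹ ≤ 4 := by
      rw [← Real.rpow_neg (by norm_num)]
      calc (2:ℝ) ^ (-(-β - 1)) ≤ 2 ^ (2:ℝ) :=
            Real.rpow_le_rpow_of_exponent_le (by norm_num) (by linarith)
        _ = 4 := by norm_num
    calc _ = ((2:ℝ) ^ (-β - 1))⁻¹ := by field_simp
      _ ≤ _ := this
  have e2 : 2 * mlf β r / r * (r ^ (1 - β) / (1 - β)) * r ^ β ≤ 2 / (1 - β) := by
    rw [Real.rpow_sub h, Real.rpow_one]
    calc _ = mlf β r * (2 / (1 - β)) := by field_simp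
      _ ≤ 1 * (2 / (1 - β)) := by gcongr
      _ = _ := one_mul _
  rw [le_div_iff₀ hG]
  rw [Real.rpow_neg h.le] at hid
  have h5 := mul_le_mul_of_nonneg_right hInt hrp.le
  set I := ∫ s in (0:ℝ)..r, (mlf β r - mlf β s) * (r - s) ^ (-β - 1)
  have h6 : -(4 + 2 / (1 - β)) ≤ I * r ^ β := by linarith
  have h7 : mlf β r - 1 + β * (I * r ^ β) = -(r ^ β * mlf β r * Real.Gamma (1 - β)) := by
    have := congrArg (· * r ^ β) hid
    rw [add_mul, mul_assoc, inv_mul_cancel₀ hrp.ne'] at this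
    linarith
  have h8 : 0 < 4 + 2 / (1 - β) := by positivity
  have h9 : -(4 + 2 / (1 - β)) ≤ β * (I * r ^ β) := by nlinarith
  linarith

theorem ml_bounds {β : ℝ} (hβ : 0 < β) (hβ1 : β < 1) : ∃ c C : ℝ, 0 < c ∧ 0 < C ∧
    ∀ x : ℝ, 0 ≤ x → c / (1 + x) ≤ mittagLeffler β (-x) ∧
      mittagLeffler β (-x) ≤ C / (1 + x) := by
  have hG : 0 < Real.Gamma (1 - β) := Real.Gamma_pos_of_pos (by linarith)
  have hb : 0 < 1 - β := by linarith
  refine ⟨1 / (1 + Real.Gamma (1 - β)), 1 + (5 + 2 / (1 - β)) / Real.Gamma (1 - β),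
    by positivity, by positivity, fun x hx => ?_⟩
  have hxx : (x ^ (1 / β)) ^ β = x := by
    rw [← Real.rpow_mul hx, one_div_mul_cancel hβ.ne', Real.rpow_one]
  have hy : 0 ≤ x ^ (1 / β) := by positivity
  have h1 := mlf_lower hβ hβ1 hy
  have h2 := mlf_upper hβ hβ1 hy
  have h3 := mlf_le_one hβ hβ1 hy
  unfold mlf at h1 h2 h3
  rw [hxx] at h1 h2 h3
  constructor
  · refine le_trans ?_ h1
    rw [div_div]
    refine one_div_le_one_div_of_le (by positivity) ?_
    nlinarith
  · rw [le_div_iff₀ (by positivity)]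
    linarith

/-- For `β ∈ (0,1)`, `μ > 0`, `t > 0`, `α > 0`, the integral
`∫_ℝ E_β²(−μ t^β |λ|^α) dλ` is finite iff `α > 1/2`. -/
theorem integrable_mittagLeffler_sq_iff (β μ t α : ℝ) (hβ : β ∈ Set.Ioo (0 : ℝ) 1)
    (hμ : 0 < μ) (ht : 0 < t) (hα : 0 < α) :
    MeasureTheory.Integrable
        (fun lam : ℝ => (mittagLeffler β (-(μ * t ^ β * |lam| ^ α))) ^ 2) ↔
      1 / 2 < α := by
  obtain ⟨c, C, hc, hC, hbd⟩ := ml_bounds hβ.1 hβ.2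
  have hm : 0 < μ * t ^ β := by positivity
  set m := μ * t ^ β
  constructor
  · intro hInt
    have h1 : IntegrableOn (fun x : ℝ => x ^ (-(2 * α))) (Set.Ioi 1) := by
      refine Integrable.mono' ((hInt.integrableOn (s := Set.Ioi 1)).const_mul (((1 + m) / c) ^ 2))
        ?_ ?_
      · exact Measurable.aestronglyMeasurable (by fun_prop)
      · refine (ae_restrict_iff' measurableSet_Ioi).mpr (Eventually.of_forall fun x hx => ?_)
        have hx1 : (1:ℝ) < x := hx
        have hx0 : (0:ℝ) < x := by linarith
        have hxa : 1 ≤ x ^ α := Real.one_le_rpow hx1.le hα.le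
        have hl := (hbd (m * |x| ^ α) (by positivity)).1
        rw [abs_of_pos hx0] at hl ⊢
        rw [Real.norm_eq_abs, abs_of_pos (by positivity), ← mul_pow, Real.rpow_neg hx0.le,
          mul_comm 2 α, Real.rpow_mul hx0.le, Real.rpow_two, ← inv_pow]
        refine pow_le_pow_left₀ (by positivity) ?_ 2
        calc (x ^ α)⁻¹ = (1 + m) / c * (c / ((1 + m) * x ^ α)) := by field_simp
          _ ≤ (1 + m) / c * (c / (1 + m * x ^ α)) := by
            gcongr
            nlinarith
          _ ≤ _ := by gcongr
    rw [integrableOn_Ioi_rpow_iff one_pos] at h1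
    linarith
  · intro h
    have h1 : Integrable (fun x : ℝ => (1 + ‖x‖) ^ (-(2 * α))) :=
      integrable_one_add_norm (by simp; linarith)
    have hcont : Continuous (fun lam : ℝ => (mittagLeffler β (-(m * |lam| ^ α))) ^ 2) := by
      have h2 : Continuous (fun lam : ℝ => -(m * |lam| ^ α)) :=
        (continuous_const.mul ((Real.continuous_rpow_const hα.le).comp continuous_abs)).neg
      exact ((ml_continuous hβ.1).comp h2).pow 2
    have hK : ∃ K : ℝ, 0 < K ∧ ∀ x : ℝ, 0 ≤ x → (1 + x) ^ α ≤ K * (1 + m * x ^ α) := by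
      refine ⟨2 ^ α * (1 + 1 / m), by positivity, fun x hx => ?_⟩
      have hxa : 0 ≤ x ^ α := by positivity
      have e1 : (1 + x) ^ α ≤ 2 ^ α * (1 + x ^ α) := by
        rcases le_total x 1 with h | h
        · have : (1 + x) ^ α ≤ 2 ^ α := Real.rpow_le_rpow (by positivity) (by linarith) hα.le
          have h2 : (0:ℝ) < 2 ^ α := by positivity
          nlinarith
        · have : (1 + x) ^ α ≤ (2 * x) ^ α :=
            Real.rpow_le_rpow (by positivity) (by linarith) hα.le
          rw [Real.mul_rpow (by norm_num) hx] at this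
          have h2 : (0:ℝ) < 2 ^ α := by positivity
          nlinarith
      refine e1.trans ?_
      rw [mul_assoc]
      refine mul_le_mul_of_nonneg_left ?_ (by positivity)
      have : (1 + 1 / m) * (1 + m * x ^ α) = 1 + x ^ α + (1 / m + m * x ^ α) := by
        field_simp
        ring
      rw [this]
      have : 0 ≤ 1 / m + m * x ^ α := by positivity
      linarith
    obtain ⟨K, hKp, hK⟩ := hK
    refine Integrable.mono' (h1.const_mul ((C * K) ^ 2)) hcont.aestronglyMeasurable ?_
    refine Eventually.of_forall fun x => ?_
    have hb := hbd (m * |x| ^ α) (by positivity)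
    have hk := hK |x| (abs_nonneg x)
    have hp : 0 ≤ mittagLeffler β (-(m * |x| ^ α)) := le_trans (by positivity) hb.1
    have hx1 : 0 < 1 + |x| := by positivity
    rw [Real.norm_eq_abs, Real.norm_eq_abs, abs_of_nonneg (by positivity), Real.rpow_neg hx1.le,
      mul_comm 2 α, Real.rpow_mul hx1.le, Real.rpow_two, ← inv_pow, ← mul_pow]
    refine pow_le_pow_left₀ hp (hb.2.trans ?_) 2
    rw [← div_eq_mul_inv, div_le_div_iff₀ (by positivity) (by positivity)]
    nlinarith
end

section
/- Let β ∈ (0,1), μ > 0, t > 0, α > 0, κ_0 ∈ (0,1). The integral ∫_ℝ E_β²(−μ t^β |λ|^α) |λ|^{κ_0−1} dλ is finite if and only if α > κ_0/2. -/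
open Real Filter Topology MeasureTheory

noncomputable def mlg (β q x : ℝ) : ℝ := ∑' k : ℕ, (-x) ^ k / Real.Gamma (β * k + q)

lemma gamma_lower {A s : ℝ} (hA : 0 < A) (hs : 1 ≤ s) :
    exp (-(A + 1)) * A ^ (s - 1) ≤ Real.Gamma s := by
  rw [Real.Gamma_eq_integral (by linarith)]
  have hint := Real.GammaIntegral_convergent (s := s) (by linarith)
  have hsub : Set.Ioc A (A + 1) ⊆ Set.Ioi 0 := fun x hx => hA.trans hx.1
  calc exp (-(A + 1)) * A ^ (s - 1)
      = ∫ x in Set.Ioc A (A + 1), exp (-(A + 1)) * A ^ (s - 1) := by simp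
    _ ≤ ∫ x in Set.Ioc A (A + 1), exp (-x) * x ^ (s - 1) := by
        apply setIntegral_mono_on (integrableOn_const (by simp)) (hint.mono_set hsub) measurableSet_Ioc
        intro x hx
        have := hx.1
        have := hx.2
        gcongr
    _ ≤ _ := by
        apply setIntegral_mono_set hint _ hsub.eventuallyLE
        filter_upwards [ae_restrict_mem measurableSet_Ioi] with x hx
        have : (0:ℝ) < x := hx
        simp only [Pi.zero_apply]
        positivity

lemma summable_ml {β q : ℝ} (hβ : 0 < β) (hq : 0 < q) (x : ℝ) :
    Summable (fun k : ℕ => |x| ^ k / Real.Gamma (β * k + q)) := by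
  set A : ℝ := (2 * (|x| + 1)) ^ (1 / β) with hAdef
  have hx : 0 ≤ |x| := abs_nonneg x
  have hA : 0 < A := by positivity
  have hAβ : A ^ β = 2 * (|x| + 1) := by
    rw [hAdef, ← Real.rpow_mul (by positivity)]
    simp [hβ.ne']
  set C := exp (-(A + 1)) * A ^ (q - 1) with hC
  have hCpos : 0 < C := by positivity
  apply Summable.of_norm_bounded_eventually_nat (g := fun k : ℕ => C⁻¹ * (1 / 2 : ℝ) ^ k)
  · exact (summable_geometric_of_lt_one (by norm_num) (by norm_num)).mul_left _
  · filter_upwards [eventually_ge_atTop (Nat.ceil (1 / β))] with k hk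
    have hk1 : 1 / β ≤ k := Nat.ceil_le.mp hk
    have hk2 : 1 ≤ β * k := by
      rw [div_le_iff₀ hβ] at hk1; linarith
    have hG := gamma_lower hA (s := β * k + q) (by linarith)
    have e : A ^ (β * k + q - 1) = (2 * (|x| + 1)) ^ k * A ^ (q - 1) := by
      rw [add_sub_assoc, Real.rpow_add hA, Real.rpow_mul hA.le, hAβ, Real.rpow_natCast]
    rw [e] at hG
    have hGpos : 0 < Real.Gamma (β * k + q) := Real.Gamma_pos_of_pos (by positivity)
    rw [Real.norm_of_nonneg (by positivity), div_le_iff₀ hGpos]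
    have h3 : C * (2 * (|x| + 1)) ^ k ≤ Real.Gamma (β * k + q) := by
      rw [hC]; linarith
    calc |x| ^ k ≤ (|x| + 1) ^ k := by gcongr; linarith
      _ = C⁻¹ * (1 / 2) ^ k * (C * (2 * (|x| + 1)) ^ k) := by
          rw [mul_pow]
          have : (1 / 2 : ℝ) ^ k * 2 ^ k = 1 := by rw [← mul_pow]; norm_num
          field_simp
          linarith
      _ ≤ _ := by gcongr

lemma mlg_differentiable {β q : ℝ} (hβ : 0 < β) (hq : 0 < q) : Differentiable ℝ (mlg β q) := by
  intro x
  let F : ℕ → ℂ → ℂ := fun k z => (-z) ^ k / (Real.Gamma (β * k + q) : ℂ)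
  have hG : ∀ k : ℕ, 0 < Real.Gamma (β * k + q) := fun k => Real.Gamma_pos_of_pos (by positivity)
  have h := Complex.differentiableOn_tsum_of_summable_norm (F := F) (U := Metric.ball 0 (|x| + 1))
    (summable_ml hβ hq (|x| + 1)) (fun k => by fun_prop) Metric.isOpen_ball (by
      intro k w hw
      simp only [F, norm_div, norm_pow, norm_neg, Complex.norm_real]
      rw [Real.norm_of_nonneg (hG k).le]
      have : ‖w‖ ≤ |(|x| + 1)| := by
        rw [abs_of_nonneg (by positivity)]; simpa using (mem_ball_zero_iff.mp hw).le
      have := (hG k).le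
      gcongr)
  have hd : DifferentiableAt ℂ (fun w => ∑' k, F k w) (x : ℂ) :=
    (h _ (by simp)).differentiableAt (Metric.isOpen_ball.mem_nhds (by simp))
  have hr := hd.hasDerivAt.real_of_complex
  have he : mlg β q = fun y : ℝ => (∑' k, F k (y : ℂ)).re := by
    funext y
    have : (∑' k : ℕ, F k (y : ℂ)) =
        ((∑' k : ℕ, (-y) ^ k / Real.Gamma (β * k + q) : ℝ) : ℂ) := by
      simp only [F]
      push_cast
      rfl
    rw [this, Complex.ofReal_re, mlg]
  rw [he]
  exact hr.differentiableAt

lemma beta_real {p q t : ℝ} (hp : 0 < p) (hq : 0 < q) (ht : 0 < t) :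
    ∫ s in Set.Ioo 0 t, (t - s) ^ (p - 1) * s ^ (q - 1) =
      t ^ (p + q - 1) * (Real.Gamma p * Real.Gamma q / Real.Gamma (p + q)) := by
  have h := Complex.betaIntegral_scaled (q : ℂ) (p : ℂ) ht
  rw [Complex.betaIntegral_eq_Gamma_mul_div _ _ (by simpa) (by simpa),
    intervalIntegral.integral_of_le ht.le, integral_Ioc_eq_integral_Ioo] at h
  apply Complex.ofReal_injective
  rw [← integral_complex_ofReal]
  have e : ∫ s in Set.Ioo 0 t, (((t - s) ^ (p - 1) * s ^ (q - 1) : ℝ) : ℂ) =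
      ∫ x in Set.Ioo 0 t, (x : ℂ) ^ ((q:ℂ) - 1) * ((t : ℂ) - x) ^ ((p:ℂ) - 1) := by
    apply setIntegral_congr_fun measurableSet_Ioo
    intro s hs
    have h1 : 0 ≤ t - s := by linarith [hs.2]
    simp only [Complex.ofReal_mul]
    rw [Complex.ofReal_cpow h1, Complex.ofReal_cpow hs.1.le]
    push_cast
    ring
  rw [e, h]
  push_cast
  rw [Complex.ofReal_cpow ht.le]
  rw [← Complex.ofReal_add, ← Complex.Gamma_ofReal, ← Complex.Gamma_ofReal, ← Complex.Gamma_ofReal]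
  push_cast
  rw [add_comm (q:ℂ) p, mul_comm (Complex.Gamma q)]

lemma beta_integrable {p q t : ℝ} (hp : 0 < p) (hq : 0 < q) (ht : 0 < t) :
    IntegrableOn (fun s => (t - s) ^ (p - 1) * s ^ (q - 1)) (Set.Ioo 0 t) := by
  apply Integrable.of_integral_ne_zero
  rw [beta_real hp hq ht]
  have := Real.Gamma_pos_of_pos hp
  have := Real.Gamma_pos_of_pos hq
  have := Real.Gamma_pos_of_pos (add_pos hp hq)
  positivity

lemma conv_ml {β p q t : ℝ} (hβ : 0 < β) (hp : 0 < p) (hq : 0 < q) (ht : 0 < t) :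
    ∫ s in Set.Ioo 0 t, (t - s) ^ (p - 1) * (s ^ (q - 1) * mlg β q (s ^ β)) =
      Real.Gamma p * (t ^ (p + q - 1) * mlg β (p + q) (t ^ β)) := by
  let F : ℕ → ℝ → ℝ := fun k s =>
    ((-1) ^ k / Real.Gamma (β * k + q)) * ((t - s) ^ (p - 1) * s ^ ((β * k + q) - 1))
  have hqk : ∀ k : ℕ, 0 < β * k + q := fun k => by positivity
  have hG : ∀ k : ℕ, 0 < Real.Gamma (β * k + q) := fun k => Real.Gamma_pos_of_pos (hqk k)
  have hF : ∀ k, Integrable (F k) (volume.restrict (Set.Ioo 0 t)) := fun k =>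
    (beta_integrable hp (hqk k) ht).const_mul _
  have hpow : ∀ k : ℕ, ∀ s : ℝ, 0 < s → ∀ r : ℝ, s ^ (β * k + r) = (s ^ β) ^ k * s ^ r := by
    intro k s hs r
    rw [Real.rpow_add hs, Real.rpow_mul hs.le, Real.rpow_natCast]
  have hnorm : ∀ k, ∫ s in Set.Ioo 0 t, ‖F k s‖ =
      Real.Gamma p * t ^ (p + q - 1) * (|t ^ β| ^ k / Real.Gamma (β * k + (p + q))) := by
    intro k
    have : ∫ s in Set.Ioo 0 t, ‖F k s‖ = ∫ s in Set.Ioo 0 t,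
        (1 / Real.Gamma (β * k + q)) * ((t - s) ^ (p - 1) * s ^ ((β * k + q) - 1)) := by
      apply setIntegral_congr_fun measurableSet_Ioo
      intro s hs
      have h1 : 0 < t - s := by linarith [hs.2]
      have h2 : 0 < s := hs.1
      simp only [F, norm_mul, norm_div, norm_pow, norm_neg, norm_one, one_pow]
      rw [Real.norm_of_nonneg (hG k).le, Real.norm_of_nonneg (by positivity : 0 ≤ (t - s) ^ (p - 1)),
        Real.norm_of_nonneg (by positivity : 0 ≤ s ^ (β * k + q - 1))]
    rw [this, integral_const_mul, beta_real hp (hqk k) ht,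
      show p + (β * k + q) - 1 = β * k + (p + q - 1) by ring, hpow k t ht,
      show p + (β * k + q) = β * k + (p + q) by ring, abs_of_nonneg (by positivity)]
    have := (hG k).ne'
    field_simp
  have hval : ∀ k, ∫ s in Set.Ioo 0 t, F k s =
      Real.Gamma p * t ^ (p + q - 1) * ((-(t ^ β)) ^ k / Real.Gamma (β * k + (p + q))) := by
    intro k
    simp only [F]
    rw [integral_const_mul, beta_real hp (hqk k) ht,
      show p + (β * k + q) - 1 = β * k + (p + q - 1) by ring, hpow k t ht,
      show p + (β * k + q) = β * k + (p + q) by ring, neg_pow (t ^ β)]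
    have := (hG k).ne'
    field_simp
  have hsum := hasSum_integral_of_summable_integral_norm hF (by
    simp only [hnorm]
    exact (summable_ml hβ (add_pos hp hq) _).mul_left _)
  have h1 := hsum.tsum_eq
  simp only [hval] at h1
  rw [tsum_mul_left] at h1
  have h2 : ∫ s in Set.Ioo 0 t, (t - s) ^ (p - 1) * (s ^ (q - 1) * mlg β q (s ^ β)) =
      ∫ s in Set.Ioo 0 t, ∑' k, F k s := by
    apply setIntegral_congr_fun measurableSet_Ioo
    intro s hs
    simp only [mlg, F]
    rw [← tsum_mul_left, ← tsum_mul_left]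
    congr 1
    ext k
    rw [add_sub_assoc, hpow k s hs.1, neg_pow (s ^ β)]
    ring
  rw [h2, ← h1, mlg]
  ring

lemma conv_ml_integrable {β p q t : ℝ} (hβ : 0 < β) (hp : 0 < p) (hq : 0 < q) (ht : 0 < t) :
    IntegrableOn (fun s => (t - s) ^ (p - 1) * (s ^ (q - 1) * mlg β q (s ^ β))) (Set.Ioo 0 t) := by
  have hc : Continuous (fun s : ℝ => mlg β q (s ^ β)) :=
    (mlg_differentiable hβ hq).continuous.comp (Real.continuous_rpow_const hβ.le)
  obtain ⟨M, hM⟩ := (isCompact_Icc (a := (0:ℝ)) (b := t)).exists_bound_of_continuousOn hc.continuousOn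
  have h := (beta_integrable hp hq ht).mul_bdd (c := M) (g := fun s => mlg β q (s ^ β))
    hc.aestronglyMeasurable (by
      filter_upwards [ae_restrict_mem measurableSet_Ioo] with s hs
      exact hM s ⟨hs.1.le, hs.2.le⟩)
  refine h.congr (Eventually.of_forall fun s => ?_)
  simp only []
  ring

lemma mlg_shift {β x : ℝ} (hβ : 0 < β) : x * mlg β (β + 1) x = 1 - mlg β 1 x := by
  have hs : Summable (fun k : ℕ => (-x) ^ k / Real.Gamma (β * k + 1)) := by
    apply Summable.of_norm
    refine (summable_ml hβ one_pos x).congr fun k => ?_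
    rw [norm_div, norm_pow, norm_neg, Real.norm_eq_abs,
      Real.norm_of_nonneg (Real.Gamma_pos_of_pos (by positivity)).le]
  have h := hs.tsum_eq_zero_add
  have e : ∑' k : ℕ, (-x) ^ (k + 1) / Real.Gamma (β * ((k + 1 : ℕ) : ℝ) + 1) =
      - (x * mlg β (β + 1) x) := by
    rw [mlg, ← tsum_mul_left, ← tsum_neg]
    congr 1
    ext k
    push_cast
    rw [show β * ((k:ℝ) + 1) + 1 = β * k + (β + 1) by ring]
    ring
  rw [e] at h
  simp only [mlg] at h ⊢
  simp at h
  linarith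

/-- the kernel `y(t) = t^(β-1) E_{β,β}(-t^β)` -/
noncomputable def mly (β t : ℝ) : ℝ := t ^ (β - 1) * mlg β β (t ^ β)

lemma mly_integrable {β t : ℝ} (hβ : 0 < β) (ht : 0 < t) :
    IntegrableOn (mly β) (Set.Ioo 0 t) := by
  refine (conv_ml_integrable hβ one_pos hβ ht).congr (Eventually.of_forall fun s => ?_)
  simp [mly]

lemma mly_integral {β t : ℝ} (hβ : 0 < β) (ht : 0 < t) :
    ∫ s in Set.Ioo 0 t, mly β s = 1 - mlg β 1 (t ^ β) := by
  have h := conv_ml hβ one_pos hβ ht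
  simp only [sub_self, rpow_zero, one_mul, Real.Gamma_one] at h
  rw [← mlg_shift hβ, add_comm β 1]
  simpa [mly] using h

lemma mly_conv_integrable {β t : ℝ} (hβ : 0 < β) (hβ1 : β < 1) (ht : 0 < t) :
    IntegrableOn (fun s => (t - s) ^ (-β) * mly β s) (Set.Ioo 0 t) := by
  refine (conv_ml_integrable hβ (sub_pos.2 hβ1) hβ ht).congr (Eventually.of_forall fun s => ?_)
  simp [mly]

lemma mly_conv {β t : ℝ} (hβ : 0 < β) (hβ1 : β < 1) (ht : 0 < t) :
    ∫ s in Set.Ioo 0 t, (t - s) ^ (-β) * mly β s = Real.Gamma (1 - β) * mlg β 1 (t ^ β) := by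
  have h := conv_ml hβ (sub_pos.2 hβ1) hβ ht
  simpa [mly] using h

lemma mly_diff {β t : ℝ} (hβ : 0 < β) (ht : 0 < t) : DifferentiableAt ℝ (mly β) t := by
  unfold mly
  have h1 : DifferentiableAt ℝ (fun t : ℝ => t ^ (β - 1)) t :=
    Real.differentiableAt_rpow_const_of_ne _ ht.ne'
  have h2 : DifferentiableAt ℝ (fun t : ℝ => t ^ β) t :=
    Real.differentiableAt_rpow_const_of_ne _ ht.ne'
  exact h1.mul (((mlg_differentiable hβ hβ) _).comp t h2)

/-- convexity bound for the kernel -/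
lemma kernel_diff {β a b : ℝ} (hβ : 0 < β) (ha : 0 < a) (hab : a ≤ b) :
    (b - a) * (β * b ^ (-β - 1)) ≤ a ^ (-β) - b ^ (-β) := by
  have hb : 0 < b := ha.trans_le hab
  rcases hab.eq_or_lt with rfl | hlt
  · simp
  obtain ⟨c, hc, h⟩ := exists_hasDerivAt_eq_slope (fun x : ℝ => x ^ (-β))
    (fun x => (-β) * x ^ (-β - 1)) hlt
    (fun x hx => (Real.continuousAt_rpow_const x _ (Or.inl (ha.trans_le hx.1).ne')).continuousWithinAt)
    (fun x hx => Real.hasDerivAt_rpow_const (Or.inl (ha.trans hx.1).ne'))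
  rw [eq_div_iff (by linarith)] at h
  have hc0 : 0 < c := ha.trans hc.1
  have : b ^ (-β - 1) ≤ c ^ (-β - 1) :=
    Real.rpow_le_rpow_of_nonpos hc0 hc.2.le (by linarith)
  have h5 : 0 ≤ (b - a) * β := mul_nonneg (by linarith) hβ.le
  nlinarith [mul_le_mul_of_nonneg_left this h5]

lemma mly_no_zero {β T : ℝ} (hβ : 0 < β) (hβ1 : β < 1) (hT : 0 < T)
    (hpos : ∀ s, 0 < s → s < T → 0 < mly β s) (hT0 : mly β T ≤ 0) : False := by
  set Γ' := Real.Gamma (1 - β) with hΓ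
  have hΓpos : 0 < Γ' := Real.Gamma_pos_of_pos (by linarith)
  set m := ∫ s in Set.Ioo 0 (T / 2), mly β s with hm
  have hmpos : 0 < m := by
    rw [hm, setIntegral_pos_iff_support_of_nonneg_ae]
    · have : Set.Ioo 0 (T / 2) ⊆ Function.support (mly β) ∩ Set.Ioo 0 (T / 2) := fun s hs =>
        ⟨(hpos s hs.1 (by linarith [hs.2])).ne', hs⟩
      refine lt_of_lt_of_le ?_ (measure_mono this)
      simp [hT]
    · filter_upwards [ae_restrict_mem measurableSet_Ioo] with s hs
      exact (hpos s hs.1 (by linarith [hs.2])).le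
    · exact mly_integrable hβ (by linarith)
  -- local Lipschitz bound
  obtain ⟨L, hL⟩ := ((mly_diff hβ hT).isBigO_sub).bound
  set δ := β * T ^ (-β - 1) * m with hδ
  have hδpos : 0 < δ := by positivity
  have hlim : Tendsto (fun t => |L| * (1 + Γ') * (T - t) ^ (1 - β)) (𝓝 T) (𝓝 0) := by
    have : ContinuousAt (fun t => |L| * (1 + Γ') * (T - t) ^ (1 - β)) T := by
      apply ContinuousAt.mul continuousAt_const
      apply ContinuousAt.rpow_const (by fun_prop)
      right; linarith
    have h2 := this.tendsto
    simpa [Real.zero_rpow (by linarith : 1 - β ≠ 0)] using h2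
  obtain ⟨ε, hε, hball⟩ := Metric.eventually_nhds_iff.1 (hL.and (hlim.eventually_lt_const hδpos))
  obtain ⟨t, ht1, ht2⟩ : ∃ t, max (max (T / 2) (T - ε)) (T - 1) < t ∧ t < T :=
    exists_between (by simp only [max_lt_iff]; refine ⟨⟨?_, ?_⟩, ?_⟩ <;> linarith)
  simp only [max_lt_iff] at ht1
  obtain ⟨⟨htT, htε⟩, ht1⟩ := ht1
  have ht0 : 0 < t := by linarith
  have hdist : ∀ s, t ≤ s → s < T → dist s T < ε := by
    intro s h1 h2
    rw [Real.dist_eq, abs_lt]; constructor <;> linarith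
  have hyb : ∀ s, t ≤ s → s < T → mly β s ≤ |L| * (T - s) := by
    intro s h1 h2
    have := (hball (hdist s h1 h2)).1
    rw [Real.norm_eq_abs, Real.norm_eq_abs, abs_sub_comm s T, abs_of_pos (by linarith : 0 < T - s)] at this
    have h3 : L * (T - s) ≤ |L| * (T - s) := by
      apply mul_le_mul_of_nonneg_right (le_abs_self L); linarith
    linarith [le_abs_self (mly β s - mly β T)]
  have hfin := (hball (hdist t le_rfl ht2)).2
  -- splitting of integrals
  have hdisj : Disjoint (Set.Ioo 0 t) (Set.Ico t T) := by
    rw [Set.disjoint_left]; intro s h1 h2; exact absurd h1.2 (not_lt.2 h2.1)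
  have hun : Set.Ioo 0 t ∪ Set.Ico t T = Set.Ioo 0 T := Set.Ioo_union_Ico_eq_Ioo ht0 ht2.le
  have hsplit : ∀ f : ℝ → ℝ, IntegrableOn f (Set.Ioo 0 T) →
      ∫ s in Set.Ioo 0 T, f s = (∫ s in Set.Ioo 0 t, f s) + ∫ s in Set.Ico t T, f s := by
    intro f hf
    rw [← hun] at hf ⊢
    exact setIntegral_union hdisj measurableSet_Ico hf.left_of_union hf.right_of_union
  have hsubI : Set.Ico t T ⊆ Set.Ioo 0 T := fun s hs => ⟨by linarith [hs.1], hs.2⟩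
  have hsub0 : Set.Ioo 0 t ⊆ Set.Ioo 0 T := fun s hs => ⟨hs.1, by linarith [hs.2]⟩
  have i1 := mly_integrable hβ hT
  have i2 := mly_conv_integrable hβ hβ1 hT
  have i3 := mly_conv_integrable hβ hβ1 ht0
  have s1 := hsplit _ i1
  have s2 := hsplit _ i2
  rw [mly_integral hβ hT, mly_integral hβ ht0] at s1
  rw [mly_conv hβ hβ1 hT] at s2
  have c3 := mly_conv hβ hβ1 ht0
  -- lower bound for the kernel difference
  have hlow : (T - t) * δ ≤ (∫ s in Set.Ioo 0 t, (t - s) ^ (-β) * mly β s) -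
      ∫ s in Set.Ioo 0 t, (T - s) ^ (-β) * mly β s := by
    rw [← integral_sub i3 (i2.mono_set hsub0)]
    calc (T - t) * δ = (T - t) * (β * T ^ (-β - 1)) * m := by rw [hδ]; ring
      _ ≤ (T - t) * (β * T ^ (-β - 1)) * ∫ s in Set.Ioo 0 t, mly β s := by
          have : 0 ≤ T - t := by linarith
          apply mul_le_mul_of_nonneg_left _ (by positivity)
          apply setIntegral_mono_set (i1.mono_set hsub0)
          · filter_upwards [ae_restrict_mem measurableSet_Ioo] with s hs
            exact (hpos s hs.1 (by linarith [hs.2])).le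
          · exact HasSubset.Subset.eventuallyLE (fun s hs => ⟨hs.1, by linarith [hs.2]⟩)
      _ = ∫ s in Set.Ioo 0 t, (T - t) * (β * T ^ (-β - 1)) * mly β s := by
          rw [integral_const_mul]
      _ ≤ _ := by
          apply setIntegral_mono_on ((i1.mono_set hsub0).const_mul _)
            (i3.sub (i2.mono_set hsub0)) measurableSet_Ioo
          intro s hs
          have hk := kernel_diff hβ (a := t - s) (b := T - s) (by linarith [hs.2]) (by linarith)
          have hy := (hpos s hs.1 (by linarith [hs.2])).le
          have hmon : T ^ (-β - 1) ≤ (T - s) ^ (-β - 1) :=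
            Real.rpow_le_rpow_of_nonpos (by linarith [hs.2]) (by linarith [hs.1]) (by linarith)
          have h1 : (T - t) * (β * T ^ (-β - 1)) ≤ (t - s) ^ (-β) - (T - s) ^ (-β) := by
            refine le_trans ?_ hk
            rw [show T - s - (t - s) = T - t by ring]
            apply mul_le_mul_of_nonneg_left _ (by linarith)
            exact mul_le_mul_of_nonneg_left hmon hβ.le
          rw [Pi.sub_apply, ← sub_mul]
          exact mul_le_mul_of_nonneg_right h1 hy
  -- upper bound
  have hup : (∫ s in Set.Ico t T, (T - s) ^ (-β) * mly β s) + Γ' * ∫ s in Set.Ico t T, mly β s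
      ≤ (T - t) * (|L| * (1 + Γ') * (T - t) ^ (1 - β)) := by
    rw [← integral_const_mul, ← integral_add (i2.mono_set hsubI) ((i1.mono_set hsubI).const_mul _)]
    calc _ ≤ ∫ s in Set.Ico t T, |L| * (1 + Γ') * (T - t) ^ (1 - β) := by
          apply setIntegral_mono_on ((i2.mono_set hsubI).add ((i1.mono_set hsubI).const_mul _))
            (integrableOn_const (by simp)) measurableSet_Ico
          intro s hs
          have hTs : 0 < T - s := by linarith [hs.2]
          have hb := hyb s hs.1 hs.2
          have hy := (hpos s (by linarith [hs.1]) hs.2).le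
          have h1 : 1 ≤ (T - s) ^ (-β) :=
            Real.one_le_rpow_of_pos_of_le_one_of_nonpos hTs (by linarith [hs.1]) (by linarith)
          calc (T - s) ^ (-β) * mly β s + Γ' * mly β s
              ≤ (T - s) ^ (-β) * mly β s + Γ' * ((T - s) ^ (-β) * mly β s) := by
                gcongr
                nlinarith
            _ = (1 + Γ') * (T - s) ^ (-β) * mly β s := by ring
            _ ≤ (1 + Γ') * (T - s) ^ (-β) * (|L| * (T - s)) := by gcongr
            _ = |L| * (1 + Γ') * (T - s) ^ (1 - β) := by
                rw [sub_eq_add_neg 1 β, Real.rpow_add hTs, Real.rpow_one]; ring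
            _ ≤ _ := by
                have h2 : T - s ≤ T - t := by linarith [hs.1]
                have h3 : 0 ≤ 1 - β := by linarith
                gcongr
      _ = _ := by
          simp [ht2.le]
  have hTt : 0 < T - t := by linarith
  have := mul_lt_mul_of_pos_left hfin hTt
  have hI : Γ' * ∫ s in Set.Ico t T, mly β s = Γ' * (mlg β 1 (t ^ β)) - Γ' * mlg β 1 (T ^ β) := by
    rw [← mul_sub]; congr 1; linarith
  linarith

lemma mlg_pos {β x : ℝ} (hβ : 0 < β) (hβ1 : β < 1) (hx : 0 ≤ x) : 0 < mlg β β x := by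
  by_contra hneg
  push Not at hneg
  have hc := (mlg_differentiable hβ hβ).continuous
  set S := Set.Icc 0 x ∩ {z | mlg β β z ≤ 0} with hS
  have hScomp : IsCompact S := isCompact_Icc.inter_right (isClosed_le hc continuous_const)
  have hSne : S.Nonempty := ⟨x, ⟨hx, le_rfl⟩, hneg⟩
  obtain ⟨z, hz, hmin⟩ := hScomp.exists_isLeast hSne
  have h0 : 0 < mlg β β 0 := by
    have : mlg β β 0 = 1 / Real.Gamma β := by
      rw [mlg, tsum_eq_single 0]
      · simp
      · intro k hk; simp [hk]
    rw [this]
    exact one_div_pos.2 (Real.Gamma_pos_of_pos hβ)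
  have hz0 : 0 < z := by
    rcases hz.1.1.eq_or_lt with h | h
    · have := hz.2
      simp only [Set.mem_setOf_eq, ← h] at this
      linarith
    · exact h
  have hT : 0 < z ^ (1 / β) := by positivity
  have hTz : (z ^ (1 / β)) ^ β = z := by
    rw [← Real.rpow_mul hz0.le]; simp [hβ.ne']
  refine mly_no_zero hβ hβ1 hT ?_ ?_
  · intro s hs hsT
    have hlt : s ^ β < z := by
      have := Real.rpow_lt_rpow hs.le hsT hβ
      rwa [hTz] at this
    have : 0 < mlg β β (s ^ β) := by
      by_contra hcon
      push Not at hcon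
      have := hmin (a := s ^ β) ⟨⟨by positivity, by linarith [hz.1.2]⟩, hcon⟩
      linarith
    unfold mly
    positivity
  · unfold mly
    rw [hTz]
    exact mul_nonpos_of_nonneg_of_nonpos (by positivity) hz.2

lemma mly_pos {β s : ℝ} (hβ : 0 < β) (hβ1 : β < 1) (hs : 0 < s) : 0 < mly β s := by
  have := mlg_pos hβ hβ1 (x := s ^ β) (by positivity)
  unfold mly
  positivity

lemma ml_lower {β x : ℝ} (hβ : 0 < β) (hβ1 : β < 1) (hx : 0 < x) :
    1 ≤ mlg β 1 x * (1 + Real.Gamma (1 - β) * x) := by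
  set t := x ^ (1 / β) with ht
  have ht0 : 0 < t := by positivity
  have htx : t ^ β = x := by
    rw [ht, ← Real.rpow_mul hx.le]; simp [hβ.ne']
  have h1 := mly_conv hβ hβ1 ht0
  have h2 := mly_integral hβ ht0
  have h3 : t ^ (-β) * ∫ s in Set.Ioo 0 t, mly β s ≤ ∫ s in Set.Ioo 0 t, (t - s) ^ (-β) * mly β s := by
    rw [← integral_const_mul]
    apply setIntegral_mono_on ((mly_integrable hβ ht0).const_mul _)
      (mly_conv_integrable hβ hβ1 ht0) measurableSet_Ioo
    intro s hs
    apply mul_le_mul_of_nonneg_right _ (mly_pos hβ hβ1 hs.1).le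
    exact Real.rpow_le_rpow_of_nonpos (by linarith [hs.2]) (by linarith [hs.1]) (by linarith)
  rw [h1, h2, Real.rpow_neg ht0.le, htx] at h3
  rw [inv_mul_le_iff₀ hx] at h3
  linarith

lemma mlg_one_pos {β x : ℝ} (hβ : 0 < β) (hβ1 : β < 1) (hx : 0 < x) : 0 < mlg β 1 x := by
  have h := ml_lower hβ hβ1 hx
  have hG : 0 < Real.Gamma (1 - β) := Real.Gamma_pos_of_pos (by linarith)
  have h2 : 0 < 1 + Real.Gamma (1 - β) * x := by positivity
  by_contra hcon
  push Not at hcon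
  nlinarith

lemma mlg_one_le {β x : ℝ} (hβ : 0 < β) (hβ1 : β < 1) (hx : 0 < x) :
    mlg β 1 x ≤ 1 := by
  have h := mlg_pos hβ hβ1 hx.le
  set t := x ^ (1 / β) with ht
  have ht0 : 0 < t := by positivity
  have htx : t ^ β = x := by
    rw [ht, ← Real.rpow_mul hx.le]; simp [hβ.ne']
  have h2 := mly_integral hβ ht0
  have h3 : 0 ≤ ∫ s in Set.Ioo 0 t, mly β s :=
    setIntegral_nonneg measurableSet_Ioo fun s hs => (mly_pos hβ hβ1 hs.1).le
  rw [htx] at h2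
  linarith

lemma mlg_one_anti {β s t : ℝ} (hβ : 0 < β) (hβ1 : β < 1) (hs : 0 < s) (hst : s ≤ t) :
    mlg β 1 (t ^ β) ≤ mlg β 1 (s ^ β) := by
  have ht : 0 < t := hs.trans_le hst
  have h1 := mly_integral hβ hs
  have h2 := mly_integral hβ ht
  have h3 : ∫ s in Set.Ioo 0 s, mly β s ≤ ∫ s in Set.Ioo 0 t, mly β s := by
    apply setIntegral_mono_set (mly_integrable hβ ht)
    · filter_upwards [ae_restrict_mem measurableSet_Ioo] with s hs
      exact (mly_pos hβ hβ1 hs.1).le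
    · exact HasSubset.Subset.eventuallyLE (Set.Ioo_subset_Ioo_right hst)
  linarith

lemma ml_upper {β x : ℝ} (hβ : 0 < β) (hβ1 : β < 1) (hx : 0 < x) :
    mlg β 1 x * x ≤ Real.Gamma (β + 1) := by
  set t := x ^ (1 / β) with ht
  have ht0 : 0 < t := by positivity
  have htx : t ^ β = x := by
    rw [ht, ← Real.rpow_mul hx.le]; simp [hβ.ne']
  have h1 := conv_ml hβ hβ one_pos ht0
  have i1 := conv_ml_integrable hβ hβ one_pos ht0
  have h2 := beta_real hβ one_pos ht0
  have i2 := beta_integrable hβ one_pos ht0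
  simp only [sub_self, rpow_zero, one_mul, mul_one, add_sub_cancel_right, Real.Gamma_one] at h1 i1 h2 i2
  rw [htx] at h1 h2
  rw [mlg_shift hβ] at h1
  have h3 : (∫ s in Set.Ioo 0 t, (t - s) ^ (β - 1)) * mlg β 1 x ≤
      ∫ s in Set.Ioo 0 t, (t - s) ^ (β - 1) * mlg β 1 (s ^ β) := by
    rw [← integral_mul_const]
    apply setIntegral_mono_on (i2.mul_const _) i1 measurableSet_Ioo
    intro s hs
    have h5 : 0 < t - s := by linarith [hs.2]
    have := mlg_one_anti hβ hβ1 hs.1 hs.2.le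
    rw [htx] at this
    gcongr
  rw [h1, h2] at h3
  have hG : 0 < Real.Gamma β := Real.Gamma_pos_of_pos hβ
  have hG1 : 0 < Real.Gamma (β + 1) := Real.Gamma_pos_of_pos (by linarith)
  have hp := mlg_one_pos hβ hβ1 hx
  have h4 : Real.Gamma β * (x * mlg β 1 x / Real.Gamma (β + 1)) ≤ Real.Gamma β * 1 := by
    calc _ = x * (Real.Gamma β / Real.Gamma (β + 1)) * mlg β 1 x := by ring
      _ ≤ _ := h3
      _ ≤ _ := by gcongr; linarith
  have h6 := le_of_mul_le_mul_left h4 hG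
  rw [div_le_one hG1] at h6
  linarith

lemma ml_eq (β x : ℝ) : mittagLeffler β (-x) = mlg β 1 x := by
  simp only [mittagLeffler, mlg, add_comm]

/-- For `β ∈ (0,1)`, `μ > 0`, `t > 0`, `α > 0`, `κ₀ ∈ (0,1)`, the integral
`∫_ℝ E_β²(−μ t^β |λ|^α) |λ|^{κ₀−1} dλ` is finite iff `α > κ₀/2`. -/
theorem integrable_mittagLeffler_sq_rpow_iff (β μ t α κ₀ : ℝ) (hβ : β ∈ Set.Ioo (0 : ℝ) 1)
    (hμ : 0 < μ) (ht : 0 < t) (hα : 0 < α) (hκ₀ : κ₀ ∈ Set.Ioo (0 : ℝ) 1) :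
    MeasureTheory.Integrable
        (fun lam : ℝ =>
          (mittagLeffler β (-(μ * t ^ β * |lam| ^ α))) ^ 2 * |lam| ^ (κ₀ - 1)) ↔
      κ₀ / 2 < α := by
  obtain ⟨hβ0, hβ1⟩ := hβ
  obtain ⟨hκ0, hκ1⟩ := hκ₀
  simp only [ml_eq]
  set c := μ * t ^ β with hc
  have hcpos : 0 < c := by positivity
  set f : ℝ → ℝ := fun l => (mlg β 1 (c * |l| ^ α)) ^ 2 * |l| ^ (κ₀ - 1) with hf
  have hmeas : Measurable f := by
    have h1 : Measurable (mlg β 1) := (mlg_differentiable hβ0 one_pos).continuous.measurable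
    have h2 : Measurable (fun l : ℝ => c * |l| ^ α) := by fun_prop
    have h3 : Measurable (fun l : ℝ => |l| ^ (κ₀ - 1)) := by fun_prop
    exact ((h1.comp h2).pow_const 2).mul h3
  have hpw : ∀ l : ℝ, 0 < l → (l ^ α)⁻¹ ^ 2 * l ^ (κ₀ - 1) = l ^ (κ₀ - 1 - 2 * α) := by
    intro l hl
    rw [← Real.rpow_neg hl.le, ← Real.rpow_natCast, ← Real.rpow_mul hl.le, ← Real.rpow_add hl]
    congr 1
    push_cast
    ring
  constructor
  · intro hint
    have h1 : IntegrableOn f (Set.Ioi 1) := hint.integrableOn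
    have hG : 0 < Real.Gamma (1 - β) := Real.Gamma_pos_of_pos (by linarith)
    set D := 1 + Real.Gamma (1 - β) * c with hD
    have hDpos : 0 < D := by positivity
    have h2 : IntegrableOn (fun l : ℝ => l ^ (κ₀ - 1 - 2 * α)) (Set.Ioi 1) := by
      refine Integrable.mono' (h1.const_mul (D ^ 2)) (by fun_prop) ?_
      filter_upwards [ae_restrict_mem measurableSet_Ioi] with l hl
      have hl1 : (1:ℝ) < l := hl
      have hl0 : 0 < l := by linarith
      have hla : 1 ≤ l ^ α := Real.one_le_rpow hl1.le hα.le
      rw [Real.norm_of_nonneg (by positivity), ← hpw l hl0]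
      simp only [hf, abs_of_pos hl0]
      have hx : 0 < c * l ^ α := by positivity
      have hlow := ml_lower hβ0 hβ1 hx
      have hp := mlg_one_pos hβ0 hβ1 hx
      have h5 : (l ^ α)⁻¹ ≤ D * mlg β 1 (c * l ^ α) := by
        rw [inv_le_iff_one_le_mul₀ (by positivity)]
        refine hlow.trans ?_
        have : 1 + Real.Gamma (1 - β) * (c * l ^ α) ≤ D * l ^ α := by rw [hD]; linarith
        nlinarith [mul_le_mul_of_nonneg_left this hp.le]
      calc (l ^ α)⁻¹ ^ 2 * l ^ (κ₀ - 1) ≤ (D * mlg β 1 (c * l ^ α)) ^ 2 * l ^ (κ₀ - 1) := by gcongr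
        _ = _ := by ring
    rw [integrableOn_Ioi_rpow_iff one_pos] at h2
    linarith
  · intro hlt
    have hpos : IntegrableOn f (Set.Ioi 0) := by
      rw [← Set.Ioc_union_Ioi_eq_Ioi zero_le_one, integrableOn_union]
      constructor
      · have h1 : IntegrableOn (fun l : ℝ => l ^ (κ₀ - 1)) (Set.Ioc 0 1) := by
          rw [← intervalIntegrable_iff_integrableOn_Ioc_of_le zero_le_one]
          exact intervalIntegral.intervalIntegrable_rpow' (by linarith)
        refine Integrable.mono' h1 hmeas.aestronglyMeasurable ?_
        filter_upwards [ae_restrict_mem measurableSet_Ioc] with l hl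
        have hl0 : 0 < l := hl.1
        have hx : 0 < c * l ^ α := by positivity
        have hp := mlg_one_pos hβ0 hβ1 hx
        have hle := mlg_one_le hβ0 hβ1 hx
        simp only [hf, abs_of_pos hl0]
        rw [Real.norm_of_nonneg (by positivity)]
        have : mlg β 1 (c * l ^ α) ^ 2 ≤ 1 := pow_le_one₀ hp.le hle
        have h7 : 0 ≤ l ^ (κ₀ - 1) := by positivity
        nlinarith
      · have h1 : IntegrableOn (fun l : ℝ => l ^ (κ₀ - 1 - 2 * α)) (Set.Ioi 1) :=
          integrableOn_Ioi_rpow_of_lt (by linarith) one_pos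
        set D := Real.Gamma (β + 1) / c with hD
        refine Integrable.mono' (h1.const_mul (D ^ 2)) hmeas.aestronglyMeasurable ?_
        filter_upwards [ae_restrict_mem measurableSet_Ioi] with l hl
        have hl1 : (1:ℝ) < l := hl
        have hl0 : 0 < l := by linarith
        have hx : 0 < c * l ^ α := by positivity
        have hp := mlg_one_pos hβ0 hβ1 hx
        have hu := ml_upper hβ0 hβ1 hx
        have hla : 0 < l ^ α := by positivity
        simp only [hf, abs_of_pos hl0]
        rw [Real.norm_of_nonneg (by positivity), ← hpw l hl0]
        have h5 : mlg β 1 (c * l ^ α) ≤ D * (l ^ α)⁻¹ := by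
          rw [hD, ← div_eq_mul_inv, div_div, le_div_iff₀ hx]
          exact hu
        calc mlg β 1 (c * l ^ α) ^ 2 * l ^ (κ₀ - 1) ≤ (D * (l ^ α)⁻¹) ^ 2 * l ^ (κ₀ - 1) := by gcongr
          _ = _ := by ring
    have hneg : IntegrableOn f (Set.Iic 0) := by
      rw [integrableOn_Iic_iff_integrableOn_Iio]
      have h := (Measure.measurePreserving_neg (volume : Measure ℝ)).integrableOn_comp_preimage
        (Homeomorph.neg ℝ).measurableEmbedding (f := f) (s := Set.Ioi 0)
      have e1 : f ∘ Neg.neg = f := by ext l; simp [hf]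
      have e2 : Neg.neg ⁻¹' Set.Ioi (0:ℝ) = Set.Iio 0 := by ext l; simp
      have h' := h.2 hpos
      rwa [e1, e2] at h'
    rw [← integrableOn_univ, ← Set.Iic_union_Ioi (a := (0:ℝ)), integrableOn_union]
    exact ⟨hneg, hpos⟩
end
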